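/- arXiv:1911.13046 — 9 statements merged into one kernel-verified Lean document; each statement's English description precedes it below -/
import Mathlib

section
/- For every real μ with μ > μ*, there exists a unique continuous nonnegative function H : [p0,0] → [0,∞) solving the fixed-point equation (FPE) for μ. Moreover this H is differentiable on [p0,0] with H'(p) = (μ − 2 ∫_{p0}^p [g ρ'(s)(H(s) − d) + β(s)] ds)^{−1/2} > 0 for every p ∈ [p0,0]; in particular H is strictly increasing and H(p0) = 0. -/
open MeasureTheory Set

/-- The primitive `B(p) = ∫_{p0}^p β`. -/
noncomputable def Bfun (p0 : ℝ) (β : ℝ → ℝ) (p : ℝ) : ℝ := ∫ s in p0..p, β s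

/-- The constant `μ* = 2 (g d ∫_{p0}^0 |ρ'| + max_{[p0,0]} B)`. -/
noncomputable def muStar (p0 d g : ℝ) (ρ' β : ℝ → ℝ) : ℝ :=
  2 * (g * d * (∫ s in p0..(0:ℝ), |ρ' s|) + sSup (Bfun p0 β '' Set.Icc p0 0))

/-- The integrand of the fixed-point equation:
`(μ − 2 ∫_{p0}^r [g ρ'(s)(H(s) − d) + β(s)] ds)^{−1/2}`. -/
noncomputable def fpeDeriv (p0 d g μ : ℝ) (ρ' β H : ℝ → ℝ) (r : ℝ) : ℝ :=
  (Real.sqrt (μ - 2 * ∫ s in p0..r, (g * ρ' s * (H s - d) + β s)))⁻¹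

/-- A continuous nonnegative function `H` on `[p0,0]` solving the fixed-point equation (FPE)
for the parameter `μ`. -/
def IsFPESolution (p0 d g μ : ℝ) (ρ' β H : ℝ → ℝ) : Prop :=
  ContinuousOn H (Set.Icc p0 0) ∧ (∀ p ∈ Set.Icc p0 (0:ℝ), 0 ≤ H p) ∧
  ∀ p ∈ Set.Icc p0 (0:ℝ), H p = ∫ r in p0..p, fpeDeriv p0 d g μ ρ' β H r

/-- The fundamental theorem of calculus on a closed interval, with one-sided derivatives at the
endpoints. -/
theorem hasDerivWithinAt_primitive_Icc {a b : ℝ} {F : ℝ → ℝ} (hF : ContinuousOn F (Icc a b))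
    {p : ℝ} (hp : p ∈ Icc a b) :
    HasDerivWithinAt (fun q => ∫ r in a..q, F r) (F p) (Icc a b) p := by
  have : Fact (p ∈ Icc a b) := ⟨hp⟩
  refine intervalIntegral.integral_hasDerivWithinAt_right ?_
    (hF.stronglyMeasurableAtFilter_nhdsWithin measurableSet_Icc p) (hF p hp)
  exact (hF.mono (Icc_subset_Icc_right hp.2)).intervalIntegrable_of_Icc hp.1

/-- A Volterra equation `f p = ∫_a^p Φ f` with `Φ` causally Lipschitz has exactly one continuous
solution. -/
theorem existsUnique_volterra {a b : ℝ} (hab : a ≤ b) {Φ : C(Icc a b, ℝ) → ℝ → ℝ}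
    (hcont : ∀ f, ContinuousOn (Φ f) (Icc a b)) {C : ℝ} (hC : 0 ≤ C)
    (hlip : ∀ f h : C(Icc a b, ℝ), ∀ r ∈ Icc a b, ∀ δ : ℝ,
      (∀ s : Icc a b, (s : ℝ) ≤ r → |f s - h s| ≤ δ) → |Φ f r - Φ h r| ≤ C * δ) :
    ∃! f : C(Icc a b, ℝ), ∀ p : Icc a b, f p = ∫ r in a..p, Φ f r := by
  let T : C(Icc a b, ℝ) → C(Icc a b, ℝ) := fun f =>
    ⟨(Icc a b).domRestrict fun p => ∫ r in a..p, Φ f r, continuousOn_iff_continuous_domRestrict.1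
      fun p hp => (hasDerivWithinAt_primitive_Icc (hcont f) hp).continuousWithinAt⟩
  have hT : ∀ f (p : Icc a b), T f p = ∫ r in a..p, Φ f r := fun _ _ => rfl
  have hint : ∀ f, ∀ p : Icc a b, IntervalIntegrable (Φ f) volume a p := fun f p =>
    ((hcont f).mono (Icc_subset_Icc_right p.2.2)).intervalIntegrable_of_Icc p.2.1
  have hbound : ∀ (f h : C(Icc a b, ℝ)) (n : ℕ) (p : Icc a b),
      |(T^[n] f) p - (T^[n] h) p| ≤ (C * (p - a)) ^ n / n.factorial * dist f h := by
    intro f h n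
    induction n with
    | zero =>
      intro p
      simpa [Real.dist_eq] using ContinuousMap.dist_apply_le_dist (f := f) (g := h) p
    | succ n ih =>
      intro p
      rw [Function.iterate_succ_apply', Function.iterate_succ_apply', hT, hT,
        ← intervalIntegral.integral_sub (hint _ p) (hint _ p), ← Real.norm_eq_abs]
      have hpoint : ∀ r ∈ Ioc a (p : ℝ), ‖Φ (T^[n] f) r - Φ (T^[n] h) r‖ ≤
          C ^ (n + 1) / n.factorial * dist f h * (r - a) ^ n := by
        intro r hr
        have h1 := hlip (T^[n] f) (T^[n] h) r ⟨hr.1.le, hr.2.trans p.2.2⟩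
          ((C * (r - a)) ^ n / n.factorial * dist f h) fun s hs => (ih s).trans (by
            have := s.2.1
            have : 0 ≤ (s : ℝ) - a := by linarith
            gcongr)
        refine h1.trans_eq ?_
        rw [mul_pow]
        ring
      refine (intervalIntegral.norm_integral_le_of_norm_le p.2.1 (ae_of_all _ hpoint)
        (Continuous.intervalIntegrable (by fun_prop) _ _)).trans_eq ?_
      rw [intervalIntegral.integral_const_mul,
        intervalIntegral.integral_comp_sub_right (fun x => x ^ n) a, integral_pow,
        Nat.factorial_succ, mul_pow]
      push_cast
      have : (n.factorial : ℝ) ≠ 0 := by positivity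
      field_simp
      simp
  obtain ⟨n, hn⟩ := (FloorSemiring.tendsto_pow_div_factorial_atTop (C * (b - a))).eventually
    (gt_mem_nhds zero_lt_one) |>.exists
  have hba : 0 ≤ b - a := sub_nonneg.2 hab
  have hK : (0 : ℝ) ≤ (C * (b - a)) ^ n / n.factorial := by positivity
  have hcontr : ContractingWith ⟨_, hK⟩ T^[n] := by
    refine ⟨hn, LipschitzWith.of_dist_le_mul fun f h => ?_⟩
    refine (ContinuousMap.dist_le (mul_nonneg hK dist_nonneg)).2 fun p => ?_
    refine (hbound f h n p).trans ?_
    have h1 : 0 ≤ (p : ℝ) - a := sub_nonneg.2 p.2.1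
    have h2 := p.2.2
    change _ ≤ (C * (b - a)) ^ n / n.factorial * dist f h
    gcongr
  have hfix : ∀ f, (∀ p : Icc a b, f p = ∫ r in a..p, Φ f r) ↔ Function.IsFixedPt T f :=
    fun f => ⟨fun hf => ContinuousMap.ext fun p => (hf p).symm, fun hf p => by rw [← hT, hf.eq]⟩
  simp only [hfix]
  exact ⟨_, hcontr.isFixedPt_fixedPoint_iterate,
    fun f hf => hcontr.fixedPoint_unique (hf.iterate n)⟩

theorem abs_inv_sqrt_sub_inv_sqrt_le {ε x y : ℝ} (hε : 0 < ε) (hx : ε ≤ x) (hy : ε ≤ y) :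
    |(√x)⁻¹ - (√y)⁻¹| ≤ |x - y| / (ε * √ε) := by
  have h0 : 0 < √ε := Real.sqrt_pos.2 hε
  have hx1 : √ε ≤ √x := Real.sqrt_le_sqrt hx
  have hy1 : √ε ≤ √y := Real.sqrt_le_sqrt hy
  have hx0 := h0.trans_le hx1
  have hy0 := h0.trans_le hy1
  have key : (√x)⁻¹ - (√y)⁻¹ = (y - x) / (√x * √y * (√x + √y)) := by
    rw [← Real.sq_sqrt (hε.le.trans hx), ← Real.sq_sqrt (hε.le.trans hy)]
    rw [Real.sqrt_sq hx0.le, Real.sqrt_sq hy0.le]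
    field_simp
    ring
  rw [key, abs_div, abs_sub_comm y x, abs_of_pos (by positivity : 0 < √x * √y * (√x + √y))]
  have hε' : ε = √ε * √ε := (Real.mul_self_sqrt hε.le).symm
  have : ε * √ε ≤ √x * √y * (√x + √y) := by
    calc ε * √ε = √ε * √ε * √ε := by rw [← hε']
      _ ≤ √x * √y * (√x + √y) := by
        gcongr
        linarith
  gcongr

theorem MeasureTheory.IntegrableOn.intervalIntegrable_of_mem_Icc {f : ℝ → ℝ} {a b r : ℝ}
    (hf : IntegrableOn f (Icc a b)) (hr : r ∈ Icc a b) : IntervalIntegrable f volume a r :=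
  (intervalIntegrable_iff_integrableOn_Icc_of_le hr.1).2 (hf.mono_set (Icc_subset_Icc_right hr.2))

theorem continuousOn_primitive_of_integrableOn_Icc {f : ℝ → ℝ} {a b : ℝ}
    (hf : IntegrableOn f (Icc a b)) : ContinuousOn (fun x => ∫ s in a..x, f s) (Icc a b) :=
  (intervalIntegral.continuousOn_primitive hf).congr fun _ hx =>
    intervalIntegral.integral_of_le hx.1

theorem integral_le_integral_of_nonneg_of_mem_Icc {f : ℝ → ℝ} {a b r : ℝ}
    (hf : IntegrableOn f (Icc a b)) (h0 : ∀ s, 0 ≤ f s) (hr : r ∈ Icc a b) :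
    ∫ s in a..r, f s ≤ ∫ s in a..b, f s :=
  intervalIntegral.integral_mono_interval le_rfl hr.1 hr.2 (ae_of_all _ h0)
    (hf.intervalIntegrable_of_mem_Icc ⟨hr.1.trans hr.2, le_rfl⟩)

section FPE

variable {p0 d g μ : ℝ} {ρ' β H K : ℝ → ℝ}

theorem integrableOn_fpe_source (hρ : IntegrableOn ρ' (Icc p0 0)) (hβ : IntegrableOn β (Icc p0 0))
    (hH : ContinuousOn H (Icc p0 0)) :
    IntegrableOn (fun s => g * ρ' s * (H s - d) + β s) (Icc p0 0) :=
  (IntegrableOn.mul_continuousOn (hρ.const_mul g) (hH.sub continuousOn_const)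
    isCompact_Icc).add hβ

theorem Bfun_le_sSup (hβ : IntegrableOn β (Icc p0 0)) {r : ℝ} (hr : r ∈ Icc p0 0) :
    Bfun p0 β r ≤ sSup (Bfun p0 β '' Icc p0 0) :=
  le_csSup (isCompact_Icc.image_of_continuousOn
    (continuousOn_primitive_of_integrableOn_Icc hβ)).bddAbove (mem_image_of_mem _ hr)

theorem sub_muStar_le (hd : 0 < d) (hg : 0 < g) (hρ : IntegrableOn ρ' (Icc p0 0))
    (hneg : ∀ᵐ s ∂(volume.restrict (Icc p0 (0 : ℝ))), ρ' s ≤ 0) (hβ : IntegrableOn β (Icc p0 0))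
    (hH : ContinuousOn H (Icc p0 0)) (hH0 : ∀ p ∈ Icc p0 (0 : ℝ), 0 ≤ H p)
    {r : ℝ} (hr : r ∈ Icc p0 0) :
    μ - muStar p0 d g ρ' β ≤ μ - 2 * ∫ s in p0..r, (g * ρ' s * (H s - d) + β s) := by
  have hρr : IntervalIntegrable (fun s => |ρ' s|) volume p0 r :=
    IntegrableOn.intervalIntegrable_of_mem_Icc hρ.norm hr
  have hβr := hβ.intervalIntegrable_of_mem_Icc hr
  have h1 : ∫ s in p0..r, (g * ρ' s * (H s - d) + β s) ≤
      ∫ s in p0..r, (g * d * |ρ' s| + β s) := by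
    refine intervalIntegral.integral_mono_ae_restrict hr.1
      ((integrableOn_fpe_source hρ hβ hH).intervalIntegrable_of_mem_Icc hr)
      ((hρr.const_mul _).add hβr) ?_
    have hsub : Icc p0 r ⊆ Icc p0 0 := Icc_subset_Icc_right hr.2
    filter_upwards [ae_restrict_of_ae_restrict_of_subset hsub hneg,
      ae_restrict_mem measurableSet_Icc] with s hs hs'
    rw [abs_of_nonpos hs]
    have : 0 ≤ g * -ρ' s * H s :=
      mul_nonneg (mul_nonneg hg.le (neg_nonneg.2 hs)) (hH0 s (hsub hs'))
    linarith
  rw [intervalIntegral.integral_add (hρr.const_mul _) hβr,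
    intervalIntegral.integral_const_mul] at h1
  have h2 : ∫ s in p0..r, |ρ' s| ≤ ∫ s in p0..0, |ρ' s| :=
    integral_le_integral_of_nonneg_of_mem_Icc hρ.norm (fun s => abs_nonneg _) hr
  have h3 := mul_le_mul_of_nonneg_left h2 (mul_pos hg hd).le
  have h4 := Bfun_le_sSup hβ hr
  simp only [Bfun] at h4
  simp only [muStar, Bfun]
  linarith

theorem fpeDeriv_pos (hpos : ∀ r ∈ Icc p0 (0 : ℝ),
      0 < μ - 2 * ∫ s in p0..r, (g * ρ' s * (H s - d) + β s)) {r : ℝ} (hr : r ∈ Icc p0 0) :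
    0 < fpeDeriv p0 d g μ ρ' β H r :=
  inv_pos.2 (Real.sqrt_pos.2 (hpos r hr))

theorem continuousOn_fpeDeriv (hρ : IntegrableOn ρ' (Icc p0 0)) (hβ : IntegrableOn β (Icc p0 0))
    (hH : ContinuousOn H (Icc p0 0)) (hpos : ∀ r ∈ Icc p0 (0 : ℝ),
      0 < μ - 2 * ∫ s in p0..r, (g * ρ' s * (H s - d) + β s)) :
    ContinuousOn (fpeDeriv p0 d g μ ρ' β H) (Icc p0 0) :=
  ContinuousOn.inv₀ (Real.continuous_sqrt.comp_continuousOn (continuousOn_const.sub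
    (continuousOn_const.mul (continuousOn_primitive_of_integrableOn_Icc
      (integrableOn_fpe_source hρ hβ hH))))) fun r hr => (Real.sqrt_pos.2 (hpos r hr)).ne'

theorem fpeDeriv_congr (h : EqOn H K (Icc p0 0)) :
    EqOn (fpeDeriv p0 d g μ ρ' β H) (fpeDeriv p0 d g μ ρ' β K) (Icc p0 0) := by
  intro r hr
  have : ∫ s in p0..r, (g * ρ' s * (H s - d) + β s) =
      ∫ s in p0..r, (g * ρ' s * (K s - d) + β s) := by
    refine intervalIntegral.integral_congr fun s hs => ?_
    rw [uIcc_of_le hr.1] at hs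
    simp only [h ⟨hs.1, hs.2.trans hr.2⟩]
  simp only [fpeDeriv, this]

theorem abs_fpeDeriv_sub_le (hg : 0 < g) (hρ : IntegrableOn ρ' (Icc p0 0))
    (hβ : IntegrableOn β (Icc p0 0)) (hH : ContinuousOn H (Icc p0 0))
    (hK : ContinuousOn K (Icc p0 0)) {ε : ℝ} (hε : 0 < ε) {r : ℝ} (hr : r ∈ Icc p0 0)
    (hHε : ε ≤ μ - 2 * ∫ s in p0..r, (g * ρ' s * (H s - d) + β s))
    (hKε : ε ≤ μ - 2 * ∫ s in p0..r, (g * ρ' s * (K s - d) + β s))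
    {δ : ℝ} (hδ : ∀ s ∈ Icc p0 r, |H s - K s| ≤ δ) :
    |fpeDeriv p0 d g μ ρ' β H r - fpeDeriv p0 d g μ ρ' β K r| ≤
      2 * g * (∫ s in p0..0, |ρ' s|) / (ε * √ε) * δ := by
  have hδ0 : 0 ≤ δ := (abs_nonneg _).trans (hδ r ⟨hr.1, le_rfl⟩)
  refine (abs_inv_sqrt_sub_inv_sqrt_le hε hHε hKε).trans ?_
  rw [div_mul_eq_mul_div]
  gcongr
  have hρr := IntegrableOn.intervalIntegrable_of_mem_Icc hρ.norm hr
  have h1 : |∫ s in p0..r, ((g * ρ' s * (K s - d) + β s) - (g * ρ' s * (H s - d) + β s))| ≤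
      ∫ s in p0..r, g * δ * |ρ' s| := by
    rw [← Real.norm_eq_abs]
    refine intervalIntegral.norm_integral_le_of_norm_le hr.1 (ae_of_all _ fun s hs => ?_)
      (hρr.const_mul _)
    have h := hδ s (Ioc_subset_Icc_self hs)
    rw [abs_sub_comm] at h
    calc ‖(g * ρ' s * (K s - d) + β s) - (g * ρ' s * (H s - d) + β s)‖
        = ‖g * ρ' s * (K s - H s)‖ := by ring_nf
      _ = g * |ρ' s| * |K s - H s| := by
        rw [Real.norm_eq_abs, abs_mul, abs_mul, abs_of_pos hg]
      _ ≤ g * |ρ' s| * δ := by gcongr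
      _ = g * δ * |ρ' s| := by ring
  rw [intervalIntegral.integral_const_mul, intervalIntegral.integral_sub
    ((integrableOn_fpe_source hρ hβ hK).intervalIntegrable_of_mem_Icc hr)
    ((integrableOn_fpe_source hρ hβ hH).intervalIntegrable_of_mem_Icc hr)] at h1
  have h2 : ∫ s in p0..r, |ρ' s| ≤ ∫ s in p0..0, |ρ' s| :=
    integral_le_integral_of_nonneg_of_mem_Icc hρ.norm (fun s => abs_nonneg _) hr
  have h3 := mul_le_mul_of_nonneg_left h2 (mul_nonneg hg.le hδ0)
  rw [show ∀ x y : ℝ, μ - 2 * x - (μ - 2 * y) = 2 * (y - x) from fun x y => by ring, abs_mul,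
    abs_of_pos two_pos]
  linarith

end FPE

/-- for every `μ > μ*` the fixed-point equation (FPE) possesses a unique continuous
nonnegative solution `H` on `[p0,0]`; moreover `H` is differentiable with positive derivative
`H'(p) = (μ − 2 ∫_{p0}^p [g ρ'(s)(H(s) − d) + β(s)] ds)^{−1/2}`, strictly increasing, and
`H(p0) = 0`. -/
theorem fpe_existence_uniqueness
    (p0 d g : ℝ) (ρ' β : ℝ → ℝ)
    (hp0 : p0 < 0) (hd : 0 < d) (hg : 0 < g)
    (hρint : IntegrableOn ρ' (Set.Icc p0 0))
    (hρneg : ∀ᵐ s ∂(volume.restrict (Set.Icc p0 (0:ℝ))), ρ' s ≤ 0)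
    (hβint : IntegrableOn β (Set.Icc p0 0))
    (μ : ℝ) (hμ : muStar p0 d g ρ' β < μ) :
    ∃ H : ℝ → ℝ, IsFPESolution p0 d g μ ρ' β H ∧
      (∀ H' : ℝ → ℝ, IsFPESolution p0 d g μ ρ' β H' →
        ∀ p ∈ Set.Icc p0 (0:ℝ), H' p = H p) ∧
      (∀ p ∈ Set.Icc p0 (0:ℝ),
        HasDerivWithinAt H (fpeDeriv p0 d g μ ρ' β H p) (Set.Icc p0 0) p ∧
          0 < fpeDeriv p0 d g μ ρ' β H p) ∧
      StrictMonoOn H (Set.Icc p0 0) ∧ H p0 = 0 := by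
  have hp0' : p0 ≤ 0 := hp0.le
  have hε : 0 < μ - muStar p0 d g ρ' β := sub_pos.2 hμ
  have hlow : ∀ {H : ℝ → ℝ}, ContinuousOn H (Icc p0 0) → (∀ p ∈ Icc p0 (0 : ℝ), 0 ≤ H p) →
      ∀ r ∈ Icc p0 (0 : ℝ), μ - muStar p0 d g ρ' β ≤
        μ - 2 * ∫ s in p0..r, (g * ρ' s * (H s - d) + β s) :=
    fun hH hH0 r hr => sub_muStar_le hd hg hρint hρneg hβint hH hH0 hr
  have hpos : ∀ {H : ℝ → ℝ}, ContinuousOn H (Icc p0 0) → (∀ p ∈ Icc p0 (0 : ℝ), 0 ≤ H p) →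
      ∀ r ∈ Icc p0 (0 : ℝ), 0 < μ - 2 * ∫ s in p0..r, (g * ρ' s * (H s - d) + β s) :=
    fun hH hH0 r hr => hε.trans_le (hlow hH hH0 r hr)
  let P : C(Icc p0 0, ℝ) → ℝ → ℝ := fun f x => max (IccExtend hp0' f x) 0
  have hPc : ∀ f, ContinuousOn (P f) (Icc p0 0) := fun f =>
    (f.continuous.Icc_extend'.max continuous_const).continuousOn
  have hP0 : ∀ f, ∀ p ∈ Icc p0 (0 : ℝ), 0 ≤ P f p := fun f p _ => le_max_right _ _
  have hPeq : ∀ f (p : Icc p0 (0 : ℝ)), P f p = max (f p) 0 := fun f p => by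
    simp only [P, IccExtend_val]
  obtain ⟨f, hf, huniq⟩ := existsUnique_volterra hp0'
    (Φ := fun f => fpeDeriv p0 d g μ ρ' β (P f))
    (C := 2 * g * (∫ s in p0..0, |ρ' s|) /
      ((μ - muStar p0 d g ρ' β) * √(μ - muStar p0 d g ρ' β)))
    (fun f => continuousOn_fpeDeriv hρint hβint (hPc f) (hpos (hPc f) (hP0 f)))
    (by
      have := intervalIntegral.integral_nonneg (f := fun s => |ρ' s|) (μ := volume) hp0'
        fun s _ => abs_nonneg _
      positivity)
    (fun f h r hr δ hδ => abs_fpeDeriv_sub_le hg hρint hβint (hPc f) (hPc h) hε hr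
      (hlow (hPc f) (hP0 f) r hr) (hlow (hPc h) (hP0 h) r hr) fun s hs => by
        have hs' : s ∈ Icc p0 0 := ⟨hs.1, hs.2.trans hr.2⟩
        rw [hPeq f ⟨s, hs'⟩, hPeq h ⟨s, hs'⟩]
        exact (abs_max_sub_max_le_abs _ _ _).trans (hδ ⟨s, hs'⟩ hs.2))
  have hf0 : ∀ p, 0 ≤ f p := fun p => by
    rw [hf p]
    exact intervalIntegral.integral_nonneg p.2.1 fun r hr =>
      inv_nonneg.2 (Real.sqrt_nonneg _)
  have hPf : ∀ p (hp : p ∈ Icc p0 0), P f p = ∫ r in p0..p, fpeDeriv p0 d g μ ρ' β (P f) r :=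
    fun p hp => by rw [hPeq f ⟨p, hp⟩, max_eq_left (hf0 _), hf ⟨p, hp⟩]
  have hcont := continuousOn_fpeDeriv hρint hβint (hPc f) (hpos (hPc f) (hP0 f))
  have hderiv : ∀ p ∈ Icc p0 (0 : ℝ),
      HasDerivWithinAt (P f) (fpeDeriv p0 d g μ ρ' β (P f) p) (Icc p0 0) p := fun p hp =>
    (hasDerivWithinAt_primitive_Icc hcont hp).congr hPf (hPf p hp)
  have hdpos : ∀ p ∈ Icc p0 (0 : ℝ), 0 < fpeDeriv p0 d g μ ρ' β (P f) p := fun p hp =>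
    fpeDeriv_pos (hpos (hPc f) (hP0 f)) hp
  refine ⟨P f, ⟨hPc f, hP0 f, hPf⟩, fun H hH p hp => ?_, fun p hp => ⟨hderiv p hp, hdpos p hp⟩,
    strictMonoOn_of_hasDerivWithinAt_pos (convex_Icc _ _) (hPc f)
      (fun p hp => (hderiv p (interior_subset hp)).mono interior_subset)
      fun p hp => hdpos p (interior_subset hp), by
    rw [hPf p0 (left_mem_Icc.2 hp0'), intervalIntegral.integral_same]⟩
  obtain ⟨hHc, hH0, hHeq⟩ := hH
  let h : C(Icc p0 0, ℝ) := ⟨(Icc p0 0).domRestrict H, hHc.domRestrict⟩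
  have hPh : EqOn H (P h) (Icc p0 0) := fun p hp => by
    rw [hPeq h ⟨p, hp⟩]
    exact (max_eq_left (hH0 p hp)).symm
  have hhf : h = f := huniq h fun p => by
    refine (hHeq p p.2).trans (intervalIntegral.integral_congr fun r hr => ?_)
    rw [uIcc_of_le p.2.1] at hr
    exact fpeDeriv_congr hPh ⟨hr.1, hr.2.trans p.2.2⟩
  rw [hPh hp, hhf]
end

section
/- Let μ > μ* and let H : [p0,0] → [0,∞) be a continuous solution of the fixed-point equation (FPE) for μ. Then for every p ∈ [p0,0] one has H(p) ≤ (p − p0)/(μ − μ*)^{1/2}; in particular H(p) ≤ |p0|/(μ − μ*)^{1/2}. -/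
open MeasureTheory Set

theorem continuousOn_Bfun {p0 : ℝ} {β : ℝ → ℝ} (hp0 : p0 ≤ 0)
    (hβ : IntegrableOn β (Icc p0 0)) : ContinuousOn (Bfun p0 β) (Icc p0 0) := by
  rw [← uIcc_of_le hp0] at hβ ⊢
  exact intervalIntegral.continuousOn_primitive_interval hβ

theorem two_mul_integral_le_muStar {p0 d g : ℝ} {ρ' β H : ℝ → ℝ} (hd : 0 < d) (hg : 0 < g)
    (hρ : IntegrableOn ρ' (Icc p0 0))
    (hρneg : ∀ᵐ s ∂(volume.restrict (Icc p0 (0:ℝ))), ρ' s ≤ 0)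
    (hβ : IntegrableOn β (Icc p0 0)) (hHc : ContinuousOn H (Icc p0 0))
    (hH0 : ∀ p ∈ Icc p0 (0:ℝ), 0 ≤ H p) {r : ℝ} (hr : r ∈ Icc p0 (0:ℝ)) :
    2 * ∫ s in p0..r, (g * ρ' s * (H s - d) + β s) ≤ muStar p0 d g ρ' β := by
  have hp0 : p0 ≤ 0 := hr.1.trans hr.2
  have hsub : Icc p0 r ⊆ Icc p0 0 := Icc_subset_Icc_right hr.2
  have hsub' : uIcc p0 r ⊆ Icc p0 0 := by rwa [uIcc_of_le hr.1]
  have hβr : IntervalIntegrable β volume p0 r := (hβ.mono_set hsub').intervalIntegrable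
  have habs0 : IntervalIntegrable (fun s => |ρ' s|) volume p0 0 := by
    have h : IntegrableOn ρ' (uIcc p0 0) := by rwa [uIcc_of_le hp0]
    exact h.intervalIntegrable.abs
  have habs : IntervalIntegrable (fun s => |ρ' s|) volume p0 r :=
    (hρ.mono_set hsub').intervalIntegrable.abs
  have hprod : IntervalIntegrable (fun s => g * ρ' s * (H s - d)) volume p0 r :=
    ((hρ.mono_set hsub').intervalIntegrable.const_mul g).mul_continuousOn
      ((hHc.mono hsub').sub continuousOn_const)
  have hmono : ∫ s in p0..r, g * ρ' s * (H s - d) ≤ ∫ s in p0..r, g * d * |ρ' s| := by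
    refine intervalIntegral.integral_mono_ae_restrict hr.1 hprod (habs.const_mul _) ?_
    filter_upwards [ae_restrict_of_ae_restrict_of_subset hsub hρneg,
      ae_restrict_mem measurableSet_Icc] with s hs hmem
    rw [abs_of_nonpos hs]
    nlinarith [mul_nonneg hg.le (mul_nonneg (neg_nonneg.2 hs) (hH0 s (hsub hmem)))]
  have hext : ∫ s in p0..r, |ρ' s| ≤ ∫ s in p0..(0:ℝ), |ρ' s| :=
    intervalIntegral.integral_mono_interval le_rfl hr.1 hr.2
      (Filter.Eventually.of_forall fun s => abs_nonneg _) habs0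
  have hB : ∫ s in p0..r, β s ≤ sSup (Bfun p0 β '' Icc p0 0) :=
    le_csSup (isCompact_Icc.image_of_continuousOn (continuousOn_Bfun hp0 hβ)).bddAbove
      (mem_image_of_mem _ hr)
  rw [intervalIntegral.integral_add hprod hβr]
  rw [intervalIntegral.integral_const_mul] at hmono
  have := mul_le_mul_of_nonneg_left hext (mul_pos hg hd).le
  unfold muStar
  linarith

/-- any continuous solution of the fixed-point equation (FPE) for `μ > μ*`
satisfies `H(p) ≤ (p − p0)/(μ − μ*)^{1/2}`; in particular `H(p) ≤ |p0|/(μ − μ*)^{1/2}`. -/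
theorem fpe_solution_upper_bound
    (p0 d g : ℝ) (ρ' β : ℝ → ℝ)
    (hp0 : p0 < 0) (hd : 0 < d) (hg : 0 < g)
    (hρint : IntegrableOn ρ' (Set.Icc p0 0))
    (hρneg : ∀ᵐ s ∂(volume.restrict (Set.Icc p0 (0:ℝ))), ρ' s ≤ 0)
    (hβint : IntegrableOn β (Set.Icc p0 0))
    (μ : ℝ) (hμ : muStar p0 d g ρ' β < μ)
    (H : ℝ → ℝ) (hH : IsFPESolution p0 d g μ ρ' β H) :
    ∀ p ∈ Set.Icc p0 (0:ℝ),
      H p ≤ (p - p0) / Real.sqrt (μ - muStar p0 d g ρ' β) ∧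
      H p ≤ |p0| / Real.sqrt (μ - muStar p0 d g ρ' β) := by
  intro p hp
  obtain ⟨hHc, hH0, hHeq⟩ := hH
  have hpos : 0 < Real.sqrt (μ - muStar p0 d g ρ' β) := Real.sqrt_pos.2 (sub_pos.2 hμ)
  have hderiv : ∀ r ∈ uIoc p0 p,
      ‖fpeDeriv p0 d g μ ρ' β H r‖ ≤ (Real.sqrt (μ - muStar p0 d g ρ' β))⁻¹ := by
    intro r hr
    rw [uIoc_of_le hp.1] at hr
    have h := two_mul_integral_le_muStar hd hg hρint hρneg hβint hHc hH0
      ⟨hr.1.le, hr.2.trans hp.2⟩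
    unfold fpeDeriv
    rw [Real.norm_of_nonneg (inv_nonneg.2 (Real.sqrt_nonneg _))]
    exact inv_anti₀ hpos (Real.sqrt_le_sqrt (by linarith))
  have hbound : H p ≤ (p - p0) / Real.sqrt (μ - muStar p0 d g ρ' β) := by
    have h := intervalIntegral.norm_integral_le_of_norm_le_const hderiv
    rw [← hHeq p hp, abs_of_nonneg (sub_nonneg.2 hp.1)] at h
    rw [div_eq_inv_mul]
    exact (Real.le_norm_self _).trans h
  refine ⟨hbound, hbound.trans (div_le_div_of_nonneg_right ?_ hpos.le)⟩
  rw [abs_of_neg hp0]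
  linarith [hp.2]
end

section
/- Let μ > μ*, let H : [p0,0] → [0,∞) be a continuous solution of the fixed-point equation (FPE) for μ, and let q ∈ [p0,0] be such that H(s) ≤ d for all s ∈ [p0,q]. If μ − 2 min_{[p0,0]} B > 0, then H(q) ≥ (q − p0)/(μ − 2 min_{[p0,0]} B)^{1/2}. -/
open MeasureTheory Set

/-- The infimum and the supremum of `B` over `[p0,0]` bound its values there. -/
theorem Bfun_mem_Icc_sInf_sSup {p0 r : ℝ} {β : ℝ → ℝ}
    (hβ : IntegrableOn β (Icc p0 0)) (hr : r ∈ Icc p0 0) :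
    Bfun p0 β r ∈ Icc (sInf (Bfun p0 β '' Icc p0 0)) (sSup (Bfun p0 β '' Icc p0 0)) := by
  have hK : IsCompact (Bfun p0 β '' Icc p0 0) :=
    isCompact_Icc.image_of_continuousOn (continuousOn_Bfun (hr.1.trans hr.2) hβ)
  exact ⟨csInf_le hK.bddBelow (mem_image_of_mem _ hr), le_csSup hK.bddAbove (mem_image_of_mem _ hr)⟩

/-- If `ρ' ≤ 0` and `0 ≤ H ≤ d` on `[p0,r]`, then the integral of `g ρ' (H - d)` over `[p0,r]`
lies between `0` and `g d ∫ |ρ'|`. -/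
theorem integral_buoyancy_mem_Icc {p0 d g r : ℝ} {ρ' H : ℝ → ℝ} (hd : 0 ≤ d) (hg : 0 ≤ g)
    (hr : r ∈ Icc p0 0) (hρ : IntegrableOn ρ' (Icc p0 0))
    (hρneg : ∀ᵐ s ∂(volume.restrict (Icc p0 (0 : ℝ))), ρ' s ≤ 0)
    (hint : IntervalIntegrable (fun s => g * ρ' s * (H s - d)) volume p0 r)
    (hH : ∀ s ∈ Icc p0 r, H s ∈ Icc 0 d) :
    ∫ s in p0..r, g * ρ' s * (H s - d) ∈ Icc 0 (g * d * ∫ s in p0..(0 : ℝ), |ρ' s|) := by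
  have hsub : Icc p0 r ⊆ Icc p0 0 := Icc_subset_Icc_right hr.2
  have hneg : ∀ᵐ s ∂(volume.restrict (Icc p0 r)), ρ' s ≤ 0 :=
    ae_restrict_of_ae_restrict_of_subset hsub hρneg
  have habs : IntervalIntegrable (fun s => |ρ' s|) volume p0 0 :=
    ((intervalIntegrable_iff_integrableOn_Icc_of_le (hr.1.trans hr.2)).2 hρ).abs
  have habs' : IntervalIntegrable (fun s => |ρ' s|) volume p0 r :=
    ((intervalIntegrable_iff_integrableOn_Icc_of_le hr.1).2 (hρ.mono_set hsub)).abs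
  constructor
  · refine intervalIntegral.integral_nonneg_of_ae_restrict hr.1 ?_
    filter_upwards [hneg, ae_restrict_mem measurableSet_Icc] with s hs hsr
    exact mul_nonneg_of_nonpos_of_nonpos (mul_nonpos_of_nonneg_of_nonpos hg hs)
      (sub_nonpos.2 (hH s hsr).2)
  · calc ∫ s in p0..r, g * ρ' s * (H s - d)
        ≤ ∫ s in p0..r, g * d * |ρ' s| := by
          refine intervalIntegral.integral_mono_ae_restrict hr.1 hint (habs'.const_mul _) ?_
          filter_upwards [hneg, ae_restrict_mem measurableSet_Icc] with s hs hsr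
          rw [abs_of_nonpos hs]
          nlinarith [mul_nonneg (mul_nonneg hg (neg_nonneg.2 hs)) (hH s hsr).1]
      _ = g * d * ∫ s in p0..r, |ρ' s| := intervalIntegral.integral_const_mul _ _
      _ ≤ g * d * ∫ s in p0..(0 : ℝ), |ρ' s| := by
          refine mul_le_mul_of_nonneg_left ?_ (mul_nonneg hg hd)
          exact intervalIntegral.integral_mono_interval le_rfl hr.1 hr.2
            (Filter.Eventually.of_forall fun s => abs_nonneg _) habs

/-- if `H` solves the (FPE) for `μ > μ*`, and `H ≤ d` on `[p0,q]`, and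
`μ − 2 min_{[p0,0]} B > 0`, then `H(q) ≥ (q − p0)/(μ − 2 min_{[p0,0]} B)^{1/2}`. -/
theorem fpe_solution_lower_bound
    (p0 d g : ℝ) (ρ' β : ℝ → ℝ)
    (hp0 : p0 < 0) (hd : 0 < d) (hg : 0 < g)
    (hρint : IntegrableOn ρ' (Set.Icc p0 0))
    (hρneg : ∀ᵐ s ∂(volume.restrict (Set.Icc p0 (0:ℝ))), ρ' s ≤ 0)
    (hβint : IntegrableOn β (Set.Icc p0 0))
    (μ : ℝ) (hμ : muStar p0 d g ρ' β < μ)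
    (H : ℝ → ℝ) (hH : IsFPESolution p0 d g μ ρ' β H)
    (q : ℝ) (hq : q ∈ Set.Icc p0 (0:ℝ))
    (hHd : ∀ s ∈ Set.Icc p0 q, H s ≤ d)
    (hpos : 0 < μ - 2 * sInf (Bfun p0 β '' Set.Icc p0 0)) :
    (q - p0) / Real.sqrt (μ - 2 * sInf (Bfun p0 β '' Set.Icc p0 0)) ≤ H q := by
  obtain ⟨hHc, hH0, hHeq⟩ := hH
  have hbuoy : IntegrableOn (fun s => g * ρ' s * (H s - d)) (Icc p0 0) :=
    IntegrableOn.mul_continuousOn (hρint.const_mul g) (hHc.sub continuousOn_const) isCompact_Icc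
  have hbounds : ∀ r ∈ Icc p0 q,
      0 < μ - 2 * ∫ s in p0..r, (g * ρ' s * (H s - d) + β s) ∧
      μ - 2 * ∫ s in p0..r, (g * ρ' s * (H s - d) + β s) ≤
        μ - 2 * sInf (Bfun p0 β '' Icc p0 0) := by
    intro r hr
    have hr0 : r ∈ Icc p0 0 := ⟨hr.1, hr.2.trans hq.2⟩
    have hsub : Icc p0 r ⊆ Icc p0 0 := Icc_subset_Icc_right hr0.2
    have hbuoy_r := (intervalIntegrable_iff_integrableOn_Icc_of_le hr.1).2 (hbuoy.mono_set hsub)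
    have hβ_r := (intervalIntegrable_iff_integrableOn_Icc_of_le hr.1).2 (hβint.mono_set hsub)
    have hI := integral_buoyancy_mem_Icc hd.le hg.le hr0 hρint hρneg hbuoy_r
      fun s hs => ⟨hH0 s (hsub hs), hHd s ⟨hs.1, hs.2.trans hr.2⟩⟩
    have hB := Bfun_mem_Icc_sInf_sSup hβint hr0
    rw [intervalIntegral.integral_add hbuoy_r hβ_r]
    unfold muStar at hμ
    change _ < μ - 2 * (_ + Bfun p0 β r) ∧ μ - 2 * (_ + Bfun p0 β r) ≤ _
    constructor <;> linarith [hI.1, hI.2, hB.1, hB.2]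
  have hcont : ContinuousOn (fpeDeriv p0 d g μ ρ' β H) (Icc p0 q) := by
    have hprim : ContinuousOn (fun r => ∫ s in p0..r, (g * ρ' s * (H s - d) + β s)) (Icc p0 q) :=
      (continuousOn_Bfun hp0.le (hbuoy.add hβint)).mono (Icc_subset_Icc_right hq.2)
    exact (continuousOn_const.sub (continuousOn_const.mul hprim)).sqrt.inv₀
      fun r hr => (Real.sqrt_pos.2 (hbounds r hr).1).ne'
  calc (q - p0) / Real.sqrt (μ - 2 * sInf (Bfun p0 β '' Icc p0 0))
      = ∫ _ in p0..q, (Real.sqrt (μ - 2 * sInf (Bfun p0 β '' Icc p0 0)))⁻¹ := by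
        rw [intervalIntegral.integral_const, smul_eq_mul, div_eq_mul_inv]
    _ ≤ ∫ r in p0..q, fpeDeriv p0 d g μ ρ' β H r :=
        intervalIntegral.integral_mono_on hq.1 intervalIntegrable_const
          (hcont.intervalIntegrable_of_Icc hq.1) fun r hr =>
          inv_anti₀ (Real.sqrt_pos.2 (hbounds r hr).1) (Real.sqrt_le_sqrt (hbounds r hr).2)
    _ = H q := (hHeq q hq).symm
end

section
/- There exists a map 𝐇 from (μ*, ∞) into the Banach space C([p0,0], ℝ) of continuous real-valued functions on [p0,0] equipped with the supremum norm, such that for every μ > μ* the function 𝐇(μ) is the unique continuous nonnegative solution of the fixed-point equation (FPE) for μ, and the map μ ↦ 𝐇(μ) is infinitely differentiable (of class C^∞) on the open interval (μ*, ∞). -/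
open MeasureTheory Set

/-- A map on `C([a,b])` is of Lipschitz Volterra type with constant `C` if it satisfies the
pointwise bounds that a Volterra integral operator with kernel bounded by `C` satisfies. -/
def LipschitzVolterra {a b : ℝ} (T : C(Icc a b, ℝ) → C(Icc a b, ℝ)) (C : ℝ) : Prop :=
  ∀ (f g : C(Icc a b, ℝ)) (n : ℕ) (M : ℝ), 0 ≤ M →
    (∀ s, |f s - g s| ≤ M * ((s : ℝ) - a) ^ n) →
    ∀ s, |T f s - T g s| ≤ C * M * (((s : ℝ) - a) ^ (n + 1) / (n + 1))

namespace LipschitzVolterra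

variable {a b C : ℝ} {T : C(Icc a b, ℝ) → C(Icc a b, ℝ)}

theorem abs_iterate_sub_le (hT : LipschitzVolterra T C) (hC : 0 ≤ C) (f g : C(Icc a b, ℝ))
    (n : ℕ) (s : Icc a b) :
    |T^[n] f s - T^[n] g s| ≤ dist f g * C ^ n / n.factorial * ((s : ℝ) - a) ^ n := by
  induction n generalizing s with
  | zero => simpa [Real.dist_eq] using ContinuousMap.dist_apply_le_dist (f := f) (g := g) s
  | succ n ih =>
    rw [Function.iterate_succ_apply', Function.iterate_succ_apply']
    refine (hT _ _ n _ (by positivity) ih s).trans_eq ?_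
    rw [Nat.factorial_succ]
    push_cast
    field_simp
    ring

theorem existsUnique_fixedPoint (hT : LipschitzVolterra T C) (hC : 0 ≤ C) :
    ∃! f, T f = f := by
  obtain ⟨n, hn⟩ := ((FloorSemiring.tendsto_pow_div_factorial_atTop (C * |b - a|)).eventually
    (gt_mem_nhds (show (0 : ℝ) < 1 / 2 by norm_num))).exists
  have hcontr : ContractingWith (1 / 2) T^[n] := by
    refine ⟨by norm_num, LipschitzWith.of_dist_le_mul fun f g => ?_⟩
    rw [ContinuousMap.dist_le (by positivity)]
    intro s
    have hs : (0 : ℝ) ≤ s - a := sub_nonneg.2 s.2.1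
    have hs' : (s : ℝ) - a ≤ |b - a| := (sub_le_sub_right s.2.2 a).trans (le_abs_self _)
    rw [Real.dist_eq]
    calc |T^[n] f s - T^[n] g s|
        ≤ dist f g * C ^ n / n.factorial * ((s : ℝ) - a) ^ n := hT.abs_iterate_sub_le hC f g n s
      _ ≤ dist f g * C ^ n / n.factorial * |b - a| ^ n := by gcongr
      _ = (C * |b - a|) ^ n / n.factorial * dist f g := by rw [mul_pow]; ring
      _ ≤ ((1 / 2 : NNReal) : ℝ) * dist f g := by
        gcongr
        simpa using hn.le
  exact ⟨_, hcontr.isFixedPt_fixedPoint_iterate, fun f hf =>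
    hcontr.fixedPoint_unique (Function.IsFixedPt.iterate hf n)⟩

end LipschitzVolterra

section VolterraIntegral

variable {a b : ℝ}

theorem intervalIntegrable_mul_IccExtend (hab : a ≤ b) {k : ℝ → ℝ}
    (hk : IntegrableOn k (Icc a b)) (f : C(Icc a b, ℝ)) {r : ℝ} (hr : r ∈ Icc a b) :
    IntervalIntegrable (fun s => k s * IccExtend hab f s) volume a r := by
  have h : IntegrableOn (fun s => k s * IccExtend hab f s) (Icc a b) :=
    hk.mul_continuousOn f.continuous.Icc_extend'.continuousOn isCompact_Icc
  rw [intervalIntegrable_iff_integrableOn_Icc_of_le hr.1]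
  exact h.mono_set (Icc_subset_Icc_right hr.2)

theorem abs_integral_mul_IccExtend_le (hab : a ≤ b) {k : ℝ → ℝ}
    (hk : IntegrableOn k (Icc a b)) (f : C(Icc a b, ℝ)) {r M : ℝ} (hr : r ∈ Icc a b)
    (hM : 0 ≤ M) (hf : ∀ s : Icc a b, (s : ℝ) ≤ r → |f s| ≤ M) :
    |∫ s in a..r, k s * IccExtend hab f s| ≤ (∫ s in a..b, |k s|) * M := by
  have hkb : IntervalIntegrable (fun s => |k s|) volume a b :=
    (intervalIntegrable_iff_integrableOn_Icc_of_le hab).2 hk.abs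
  have hkr : IntervalIntegrable (fun s => |k s|) volume a r :=
    hkb.mono_set (by rw [uIcc_of_le hab, uIcc_of_le hr.1]; exact Icc_subset_Icc_right hr.2)
  calc |∫ s in a..r, k s * IccExtend hab f s| ≤ ∫ s in a..r, |k s| * M := by
        rw [← Real.norm_eq_abs]
        refine intervalIntegral.norm_integral_le_of_norm_le hr.1 (.of_forall fun s hs => ?_)
          (IntervalIntegrable.mul_const hkr M)
        have hs' : s ∈ Icc a b := ⟨hs.1.le, hs.2.trans hr.2⟩
        rw [Real.norm_eq_abs, abs_mul, IccExtend_of_mem hab _ hs']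
        exact mul_le_mul_of_nonneg_left (hf ⟨s, hs'⟩ hs.2) (abs_nonneg _)
    _ = (∫ s in a..r, |k s|) * M := intervalIntegral.integral_mul_const _ _
    _ ≤ (∫ s in a..b, |k s|) * M := by
        gcongr
        exact intervalIntegral.integral_mono_interval le_rfl hr.1 hr.2
          (.of_forall fun s => abs_nonneg _) hkb

theorem continuous_integral_mul_IccExtend (hab : a ≤ b) {k : ℝ → ℝ}
    (hk : IntegrableOn k (Icc a b)) (f : C(Icc a b, ℝ)) :
    Continuous fun r : Icc a b => ∫ s in a..r, k s * IccExtend hab f s := by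
  have h : IntegrableOn (fun s => k s * IccExtend hab f s) (uIcc a b) := by
    rw [uIcc_of_le hab]
    exact hk.mul_continuousOn f.continuous.Icc_extend'.continuousOn isCompact_Icc
  have hc := intervalIntegral.continuousOn_primitive_interval h
  rw [uIcc_of_le hab] at hc
  exact hc.domRestrict

/-- The weighted primitive `f ↦ (r ↦ ∫_a^r k f)` as a continuous linear map on `C([a,b])`. -/
noncomputable def weightedPrimitive (hab : a ≤ b) (k : ℝ → ℝ) (hk : IntegrableOn k (Icc a b)) :
    C(Icc a b, ℝ) →L[ℝ] C(Icc a b, ℝ) :=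
  LinearMap.mkContinuous
    { toFun := fun f => ⟨fun r => ∫ s in a..r, k s * IccExtend hab f s,
        continuous_integral_mul_IccExtend hab hk f⟩
      map_add' := fun f g => by
        ext r
        simp only [ContinuousMap.coe_mk, ContinuousMap.add_apply]
        rw [← intervalIntegral.integral_add (intervalIntegrable_mul_IccExtend hab hk f r.2)
          (intervalIntegrable_mul_IccExtend hab hk g r.2)]
        exact intervalIntegral.integral_congr fun s _ => by simp [IccExtend, mul_add]
      map_smul' := fun c f => by
        ext r
        simp only [ContinuousMap.coe_mk, ContinuousMap.smul_apply, smul_eq_mul, RingHom.id_apply]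
        rw [← intervalIntegral.integral_const_mul]
        exact intervalIntegral.integral_congr fun s _ => by simp [IccExtend, mul_left_comm] }
    (∫ s in a..b, |k s|) fun f => by
      have hK : 0 ≤ ∫ s in a..b, |k s| :=
        intervalIntegral.integral_nonneg hab fun _ _ => abs_nonneg _
      rw [ContinuousMap.norm_le _ (by positivity)]
      exact fun r => abs_integral_mul_IccExtend_le hab hk f r.2 (norm_nonneg f)
        fun s _ => f.norm_coe_le_norm s

theorem weightedPrimitive_apply (hab : a ≤ b) {k : ℝ → ℝ} (hk : IntegrableOn k (Icc a b))
    (f : C(Icc a b, ℝ)) (r : Icc a b) :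
    weightedPrimitive hab k hk f r = ∫ s in a..r, k s * IccExtend hab f s := rfl

theorem weightedPrimitive_nonneg (hab : a ≤ b) {k : ℝ → ℝ} (hk : IntegrableOn k (Icc a b))
    (hk0 : ∀ᵐ s ∂volume.restrict (Icc a b), 0 ≤ k s) {f : C(Icc a b, ℝ)} (hf : 0 ≤ f) :
    0 ≤ weightedPrimitive hab k hk f := by
  intro r
  change 0 ≤ weightedPrimitive hab k hk f r
  rw [weightedPrimitive_apply]
  refine intervalIntegral.integral_nonneg_of_ae_restrict r.2.1 ?_
  filter_upwards [ae_restrict_of_ae_restrict_of_subset (Icc_subset_Icc_right r.2.2) hk0]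
    with s hs
  exact mul_nonneg hs (hf _)

theorem abs_weightedPrimitive_le (hab : a ≤ b) {k : ℝ → ℝ} (hk : IntegrableOn k (Icc a b))
    (f : C(Icc a b, ℝ)) (r : Icc a b) {M : ℝ} (hM : 0 ≤ M)
    (hf : ∀ s : Icc a b, s ≤ r → |f s| ≤ M) :
    |weightedPrimitive hab k hk f r| ≤ (∫ s in a..b, |k s|) * M :=
  abs_integral_mul_IccExtend_le hab hk f r.2 hM fun s hs => hf s hs

/-- The primitive `f ↦ (r ↦ ∫_a^r f)` as a continuous linear map on `C([a,b])`. -/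
noncomputable def primitive (hab : a ≤ b) : C(Icc a b, ℝ) →L[ℝ] C(Icc a b, ℝ) :=
  weightedPrimitive hab (fun _ => 1) continuousOn_const.integrableOn_Icc

theorem primitive_apply (hab : a ≤ b) (f : C(Icc a b, ℝ)) (r : Icc a b) :
    primitive hab f r = ∫ s in a..r, IccExtend hab f s := by
  simp [primitive, weightedPrimitive_apply]

theorem primitive_nonneg (hab : a ≤ b) {f : C(Icc a b, ℝ)} (hf : 0 ≤ f) :
    0 ≤ primitive hab f :=
  weightedPrimitive_nonneg hab _ (.of_forall fun _ => zero_le_one) hf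

theorem abs_primitive_le (hab : a ≤ b) (f : C(Icc a b, ℝ)) {n : ℕ} {M : ℝ}
    (hf : ∀ s, |f s| ≤ M * ((s : ℝ) - a) ^ n) (r : Icc a b) :
    |primitive hab f r| ≤ M * (((r : ℝ) - a) ^ (n + 1) / (n + 1)) := by
  rw [primitive_apply]
  calc |∫ s in a..r, IccExtend hab f s| ≤ ∫ s in a..r, M * (s - a) ^ n := by
        rw [← Real.norm_eq_abs]
        refine intervalIntegral.norm_integral_le_of_norm_le r.2.1 (.of_forall fun s hs => ?_)
          (Continuous.intervalIntegrable (by fun_prop : Continuous fun s => M * (s - a) ^ n) _ _)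
        rw [IccExtend_of_mem hab _ ⟨hs.1.le, hs.2.trans r.2.2⟩]
        exact hf ⟨s, _⟩
    _ = M * (((r : ℝ) - a) ^ (n + 1) / (n + 1)) := by
        rw [intervalIntegral.integral_const_mul,
          intervalIntegral.integral_comp_sub_right (fun x => x ^ n), integral_pow]
        simp

theorem lipschitzVolterra_weightedPrimitive_primitive (hab : a ≤ b) {k : ℝ → ℝ}
    (hk : IntegrableOn k (Icc a b)) :
    LipschitzVolterra (weightedPrimitive hab k hk ∘L primitive hab) (∫ s in a..b, |k s|) := by
  intro f g n M hM h s
  rw [← ContinuousMap.sub_apply, ← map_sub, mul_assoc]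
  have ha : ∀ r : Icc a b, (0 : ℝ) ≤ r - a := fun r => sub_nonneg.2 r.2.1
  have hs := ha s
  refine abs_weightedPrimitive_le hab hk _ s (by positivity) fun r hr => ?_
  refine (abs_primitive_le hab (f - g) h r).trans ?_
  have hra := ha r
  have hrs : (r : ℝ) ≤ s := hr
  gcongr

end VolterraIntegral

section InvSqrt

/-- The function `x ↦ x^{-1/2}`, made constant below `δ > 0`. -/
noncomputable def truncInvSqrt {δ : ℝ} (hδ : 0 < δ) : C(ℝ, ℝ) where
  toFun x := (√(max δ x))⁻¹
  continuous_toFun := by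
    refine Continuous.inv₀ (by fun_prop) fun x => ?_
    exact (Real.sqrt_pos.2 (hδ.trans_le (le_max_left _ _))).ne'

theorem truncInvSqrt_of_le {δ x : ℝ} (hδ : 0 < δ) (hx : δ ≤ x) :
    truncInvSqrt hδ x = (√x)⁻¹ := by
  simp [truncInvSqrt, max_eq_right hx]

theorem truncInvSqrt_pos {δ : ℝ} (hδ : 0 < δ) (x : ℝ) : 0 < truncInvSqrt hδ x :=
  inv_pos.2 (Real.sqrt_pos.2 (hδ.trans_le (le_max_left _ _)))

theorem abs_truncInvSqrt_sub_le {δ : ℝ} (hδ : 0 < δ) (x y : ℝ) :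
    |truncInvSqrt hδ x - truncInvSqrt hδ y| ≤ (δ * √δ)⁻¹ * |x - y| := by
  have hmax : |max δ x - max δ y| ≤ |x - y| := by
    simpa using abs_max_sub_max_le_max δ x δ y
  have hx : δ ≤ max δ x := le_max_left _ _
  have hy : δ ≤ max δ y := le_max_left _ _
  change |(√(max δ x))⁻¹ - (√(max δ y))⁻¹| ≤ _
  generalize max δ x = u at *
  generalize max δ y = v at *
  have hsu := Real.sqrt_le_sqrt hx
  have hsv := Real.sqrt_le_sqrt hy
  have hsδ := Real.sqrt_pos.2 hδ
  have hu := Real.sq_sqrt (hδ.le.trans hx)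
  have hv := Real.sq_sqrt (hδ.le.trans hy)
  have hd := Real.sq_sqrt hδ.le
  set p := √u
  set q := √v
  set e := √δ
  have hp : 0 < p := hsδ.trans_le hsu
  have hq : 0 < q := hsδ.trans_le hsv
  have key : p⁻¹ - q⁻¹ = (p * q * (p + q))⁻¹ * (v - u) := by
    rw [← hu, ← hv]; field_simp; ring
  rw [key, abs_mul, abs_of_pos (by positivity), abs_sub_comm v u]
  have h : δ * e ≤ p * q * (p + q) := by
    rw [← hd, sq]
    have : e ≤ p + q := by linarith
    gcongr
  gcongr

end InvSqrt

section AbstractEquation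

open Topology

variable {a b C : ℝ} {L : C(Icc a b, ℝ) →L[ℝ] C(Icc a b, ℝ)} {A : C(Icc a b, ℝ)}

theorem LipschitzVolterra.of_abs_sub_le {T S : C(Icc a b, ℝ) → C(Icc a b, ℝ)} {c : ℝ}
    (hT : LipschitzVolterra T C) (hc : 0 ≤ c)
    (h : ∀ f g, ∃ f' g', (∀ s, |f' s - g' s| ≤ |f s - g s|) ∧
      ∀ s, |S f s - S g s| ≤ c * |T f' s - T g' s|) :
    LipschitzVolterra S (c * C) := by
  intro f g n M hM hfg s
  obtain ⟨f', g', h₁, h₂⟩ := h f g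
  refine (h₂ s).trans ?_
  rw [mul_assoc c C, mul_assoc c]
  exact mul_le_mul_of_nonneg_left (hT f' g' n M hM (fun t => (h₁ t).trans (hfg t)) s) hc

/-- The equation `v = (μ + A + L v)^{-1/2}` has exactly one nonnegative solution when
`μ + A > 0` and `L` is a positive Volterra operator. -/
theorem existsUnique_nonneg_eq_inv_sqrt (hC : 0 ≤ C) (hL : LipschitzVolterra L C)
    (hpos : ∀ f, 0 ≤ f → 0 ≤ L f) {μ₀ μ : ℝ} (hA : ∀ r, 0 ≤ μ₀ + A r) (hμ : μ₀ < μ) :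
    ∃! v : C(Icc a b, ℝ), 0 ≤ v ∧ ∀ r, v r = (√(μ + A r + L v r))⁻¹ := by
  have hδ : 0 < μ - μ₀ := sub_pos.2 hμ
  have hlow : ∀ v, 0 ≤ v → ∀ r, μ - μ₀ ≤ μ + A r + L v r := fun v hv r => by
    have h₁ : 0 ≤ L v r := hpos v hv r
    linarith [hA r]
  let T : C(Icc a b, ℝ) → C(Icc a b, ℝ) := fun v =>
    (truncInvSqrt hδ).comp (.const _ μ + A + L |v|)
  have hT : LipschitzVolterra T (((μ - μ₀) * √(μ - μ₀))⁻¹ * C) := by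
    refine hL.of_abs_sub_le (by positivity) fun f g => ⟨|f|, |g|, fun s => ?_, fun s => ?_⟩
    · simpa using abs_abs_sub_abs_le_abs_sub (f s) (g s)
    · refine (abs_truncInvSqrt_sub_le hδ _ _).trans_eq ?_
      simp
  have hiff : ∀ v, T v = v ↔ 0 ≤ v ∧ ∀ r, v r = (√(μ + A r + L v r))⁻¹ := fun v => by
    constructor
    · intro h
      have hv : 0 ≤ v := fun r => by
        rw [← h]
        exact (truncInvSqrt_pos hδ _).le
      refine ⟨hv, fun r => ?_⟩
      conv_lhs => rw [← h]
      rw [← truncInvSqrt_of_le hδ (hlow v hv r)]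
      simp [T, abs_of_nonneg hv]
    · rintro ⟨hv, h⟩
      ext r
      rw [h r, ← truncInvSqrt_of_le hδ (hlow v hv r)]
      simp [T, abs_of_nonneg hv]
  simpa only [hiff] using hT.existsUnique_fixedPoint (by positivity)

theorem sq_mul_eq_one_iff_eq_inv_sqrt {x y : ℝ} (hx : 0 < x) :
    x ^ 2 * y = 1 ↔ x = (√y)⁻¹ := by
  constructor
  · intro h
    have hy : y = (x⁻¹) ^ 2 := by field_simp; linarith
    rw [hy, Real.sqrt_sq (by positivity), inv_inv]
  · intro h
    have hy : 0 < √y := by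
      by_contra! hy
      rw [h] at hx
      exact absurd hx (not_lt.2 (inv_nonpos.2 hy))
    rw [h, inv_pow, Real.sq_sqrt (Real.sqrt_pos.1 hy).le]
    exact inv_mul_cancel₀ (Real.sqrt_pos.1 hy).ne'

/-- Linearisation of `v ↦ v² (μ + A + L v) - 1` at a solution `v`, with `w = μ + A + L v`. -/
theorem bijective_linearization (hC : 0 ≤ C) (hL : LipschitzVolterra L C)
    {v w : C(Icc a b, ℝ)} (hvw : v ^ 2 * w = 1) :
    Function.Bijective fun h : C(Icc a b, ℝ) => (2 : ℝ) • (v * w * h) + v ^ 2 * L h := by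
  rw [Function.bijective_iff_existsUnique]
  intro z
  have hvw' : ∀ r, v r ^ 2 * w r = 1 := fun r => by simpa using DFunLike.congr_fun hvw r
  let T : C(Icc a b, ℝ) → C(Icc a b, ℝ) := fun h =>
    (2⁻¹ : ℝ) • (v * z) - (2⁻¹ : ℝ) • (v ^ 3 * L h)
  have hT : LipschitzVolterra T (2⁻¹ * ‖v‖ ^ 3 * C) := by
    refine hL.of_abs_sub_le (by positivity) fun f g => ⟨f, g, fun s => le_rfl, fun s => ?_⟩
    have h : T f s - T g s = -(2⁻¹ * v s ^ 3 * (L f s - L g s)) := by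
      simp [T]; ring
    rw [h, abs_neg, abs_mul, abs_mul, abs_pow, abs_of_pos (by norm_num : (0 : ℝ) < 2⁻¹)]
    gcongr
    exact v.norm_coe_le_norm s
  have hiff : ∀ h, T h = h ↔ (2 : ℝ) • (v * w * h) + v ^ 2 * L h = z := fun h => by
    simp only [ContinuousMap.ext_iff]
    refine forall_congr' fun r => ?_
    have hr := hvw' r
    simp only [T, ContinuousMap.sub_apply, ContinuousMap.smul_apply, ContinuousMap.mul_apply,
      ContinuousMap.add_apply, ContinuousMap.pow_apply, smul_eq_mul]
    constructor
    · intro e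
      linear_combination (-2 * v r * w r) * e + (z r - v r ^ 2 * L h r) * hr
    · intro e
      linear_combination (-v r / 2) * e + h r * hr
  simpa only [hiff] using hT.existsUnique_fixedPoint (by positivity)

/-- Smooth dependence on `μ` of positive solutions of `v = (μ + A + L v)^{-1/2}`, by the implicit
function theorem applied to `v² (μ + A + L v) - 1 = 0`. -/
theorem contDiffAt_of_unique_eq_inv_sqrt (hC : 0 ≤ C) (hL : LipschitzVolterra L C)
    {V : ℝ → C(Icc a b, ℝ)} {μ : ℝ} (hpos : ∀ r, 0 < V μ r)
    (hV : ∀ r, V μ r = (√(μ + A r + L (V μ) r))⁻¹)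
    (huniq : ∀ᶠ ν in 𝓝 μ, ∀ v : C(Icc a b, ℝ), 0 ≤ v →
      (∀ r, v r = (√(ν + A r + L v r))⁻¹) → v = V ν) :
    ContDiffAt ℝ (⊤ : ℕ∞) V μ := by
  let one : C(Icc a b, ℝ) := 1
  let F : ℝ × C(Icc a b, ℝ) → C(Icc a b, ℝ) := fun x =>
    x.2 ^ 2 * (x.1 • one + A + L x.2) - one
  have hF : ContDiff ℝ (⊤ : ℕ∞) F := by fun_prop
  have hF0 : ∀ ν (v : C(Icc a b, ℝ)), (∀ r, 0 < v r) →
      (F (ν, v) = 0 ↔ ∀ r, v r = (√(ν + A r + L v r))⁻¹) := fun ν v hv => by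
    simp only [ContinuousMap.ext_iff]
    refine forall_congr' fun r => ?_
    rw [← sq_mul_eq_one_iff_eq_inv_sqrt (hv r)]
    simp [F, one, sub_eq_zero]
  have hμ : F (μ, V μ) = 0 := (hF0 μ _ hpos).2 hV
  have hn : ((⊤ : ℕ∞) : WithTop ℕ∞) ≠ 0 := by simp
  have hinv : (fderiv ℝ F (μ, V μ) ∘L .inr ℝ ℝ C(Icc a b, ℝ)).IsInvertible := by
    set w := μ • one + A + L (V μ) with hw
    have hvw : V μ ^ 2 * w = 1 := sub_eq_zero.1 hμ
    have hd : ∀ h, (fderiv ℝ F (μ, V μ) ∘L .inr ℝ ℝ C(Icc a b, ℝ)) h =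
        (2 : ℝ) • (V μ * w * h) + V μ ^ 2 * L h := fun h => by
      have h₁ : HasFDerivAt (fun v => F (μ, v))
          (fderiv ℝ F (μ, V μ) ∘L .inr ℝ ℝ C(Icc a b, ℝ)) (V μ) :=
        ((hF.differentiable hn) (μ, V μ)).hasFDerivAt.comp (V μ) (hasFDerivAt_prodMk_right μ (V μ))
      have h₂ := ((hasFDerivAt_id (𝕜 := ℝ) (V μ)).pow 2).mul
        ((L.hasFDerivAt (x := V μ)).const_add (μ • one + A)) |>.sub_const one
      rw [h₁.unique h₂]
      simp only [hw, two_smul, id_eq, Nat.add_one_sub_one, pow_one, _root_.add_apply,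
        _root_.smul_apply, smul_eq_mul, ContinuousLinearMap.id_apply]
      ring
    have hb := bijective_linearization hC hL hvw
    rw [← funext hd] at hb
    exact ⟨.ofBijective _ (LinearMap.ker_eq_bot.2 hb.1) (LinearMap.range_eq_top.2 hb.2),
      ContinuousLinearEquiv.coe_ofBijective _ _ _⟩
  have hFa : ContDiffAt ℝ (⊤ : ℕ∞) F (μ, V μ) := hF.contDiffAt
  have hφ := hFa.contDiffAt_implicitFunction hn hinv
  have hφ0 := hFa.implicitFunction_apply_self hn hinv
  have hφF := hFa.eventually_apply_implicitFunction hn hinv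
  set φ := hFa.implicitFunction hn hinv
  refine hφ.congr_of_eventuallyEq ?_
  have hφpos : ∀ᶠ ν in 𝓝 μ, ∀ r, 0 < φ ν r := by
    have hopen : IsOpen {v : C(Icc a b, ℝ) | MapsTo v univ (Ioi 0)} :=
      ContinuousMap.isOpen_setOfPred_mapsTo isCompact_univ isOpen_Ioi
    have hmem : φ μ ∈ {v : C(Icc a b, ℝ) | MapsTo v univ (Ioi 0)} := by
      rw [show φ μ = V μ from hφ0]
      exact fun r _ => hpos r
    filter_upwards [hφ.continuousAt (hopen.mem_nhds hmem)] with ν hν r using hν (mem_univ r)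
  filter_upwards [hφpos, hφF, huniq] with ν h₁ h₂ h₃
  exact (h₃ (φ ν) (fun r => (h₁ r).le) ((hF0 ν _ h₁).1 (h₂.trans hμ))).symm

end AbstractEquation

section FPE

variable {p0 d g : ℝ} {ρ' β : ℝ → ℝ}

theorem weightedPrimitive_one {a b : ℝ} (hab : a ≤ b) {k : ℝ → ℝ}
    (hk : IntegrableOn k (Icc a b)) (r : Icc a b) :
    weightedPrimitive hab k hk 1 r = ∫ s in a..r, k s := by
  simp [weightedPrimitive_apply, IccExtend]

/-- The part of the radicand of the fixed-point equation that depends neither on `μ` nor on the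
unknown function, namely `r ↦ 2 g d ∫_{p0}^r ρ' - 2 B(r)`. -/
noncomputable def fpeOffset (hp : p0 ≤ 0) (d g : ℝ) (hρ : IntegrableOn ρ' (Icc p0 0))
    (hβ : IntegrableOn β (Icc p0 0)) : C(Icc p0 (0 : ℝ), ℝ) :=
  (2 * (g * d)) • weightedPrimitive hp ρ' hρ 1 - (2 : ℝ) • weightedPrimitive hp β hβ 1

theorem muStar_add_fpeOffset_nonneg (hp : p0 ≤ 0) (hd : 0 ≤ d) (hg : 0 ≤ g)
    (hρ : IntegrableOn ρ' (Icc p0 0)) (hβ : IntegrableOn β (Icc p0 0)) (r : Icc p0 (0 : ℝ)) :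
    0 ≤ muStar p0 d g ρ' β + fpeOffset hp d g hρ hβ r := by
  have hB : Bfun p0 β r ≤ sSup (Bfun p0 β '' Icc p0 0) := by
    have hc := intervalIntegral.continuousOn_primitive_interval (μ := volume) (f := β)
      (a := p0) (b := 0) (by rwa [uIcc_of_le hp])
    rw [uIcc_of_le hp] at hc
    exact le_csSup (isCompact_Icc.bddAbove_image hc) (mem_image_of_mem _ r.2)
  have hR := abs_le.1 <| abs_weightedPrimitive_le hp hρ 1 r zero_le_one fun s _ => by simp
  have hgd := mul_le_mul_of_nonneg_left hR.1 (mul_nonneg hg hd)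
  have hβr : weightedPrimitive hp β hβ 1 r = Bfun p0 β r := weightedPrimitive_one hp hβ r
  simp only [muStar, fpeOffset, ContinuousMap.sub_apply, ContinuousMap.smul_apply, smul_eq_mul, hβr]
  linarith

theorem fpe_radicand_eq (hp : p0 ≤ 0) (hρ : IntegrableOn ρ' (Icc p0 0))
    (hβ : IntegrableOn β (Icc p0 0))
    (hk : IntegrableOn (fun s => -(2 * g) * ρ' s) (Icc p0 0)) {H : ℝ → ℝ} {h : C(Icc p0 (0 : ℝ), ℝ)}
    (hH : ∀ p : Icc p0 (0 : ℝ), h p = H p) (μ : ℝ) (r : Icc p0 (0 : ℝ)) :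
    μ - 2 * ∫ s in p0..r, (g * ρ' s * (H s - d) + β s) =
      μ + fpeOffset hp d g hρ hβ r +
        weightedPrimitive hp _ hk h r := by
  have hsub : Icc p0 (r : ℝ) ⊆ Icc p0 0 := Icc_subset_Icc_right r.2.2
  have hii : ∀ {k : ℝ → ℝ}, IntegrableOn k (Icc p0 0) → IntervalIntegrable k volume p0 r :=
    fun hk => (intervalIntegrable_iff_integrableOn_Icc_of_le r.2.1).2 (hk.mono_set hsub)
  have hcongr : ∫ s in p0..r, (g * ρ' s * (H s - d) + β s) =
      ∫ s in p0..r, (g * (ρ' s * IccExtend hp h s) - g * d * ρ' s + β s) := by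
    refine intervalIntegral.integral_congr fun s hs => ?_
    rw [uIcc_of_le r.2.1] at hs
    simp only [IccExtend_of_mem hp h (hsub hs), hH ⟨s, hsub hs⟩]
    ring
  have h₁ := (intervalIntegrable_mul_IccExtend hp hρ h r.2).const_mul g
  have h₂ := (hii hρ).const_mul (g * d)
  rw [hcongr, intervalIntegral.integral_add (h₁.sub h₂) (hii hβ),
    intervalIntegral.integral_sub h₁ h₂, intervalIntegral.integral_const_mul,
    intervalIntegral.integral_const_mul]
  simp only [fpeOffset, ContinuousMap.sub_apply, ContinuousMap.smul_apply, smul_eq_mul,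
    weightedPrimitive_one]
  simp only [weightedPrimitive_apply, mul_assoc, intervalIntegral.integral_const_mul]
  ring

theorem isFPESolution_iff (hp : p0 ≤ 0) (hd : 0 ≤ d) (hg : 0 ≤ g)
    (hρ : IntegrableOn ρ' (Icc p0 0)) (hβ : IntegrableOn β (Icc p0 0))
    (hk : IntegrableOn (fun s => -(2 * g) * ρ' s) (Icc p0 0))
    (hk0 : ∀ᵐ s ∂volume.restrict (Icc p0 0), 0 ≤ -(2 * g) * ρ' s) {μ : ℝ}
    (hμ : muStar p0 d g ρ' β < μ) {H : ℝ → ℝ} {h : C(Icc p0 (0 : ℝ), ℝ)}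
    (hH : ∀ p : Icc p0 (0 : ℝ), h p = H p) :
    IsFPESolution p0 d g μ ρ' β H ↔ ∃ v : C(Icc p0 (0 : ℝ), ℝ), (0 ≤ v ∧ ∀ r, v r =
      (√(μ + fpeOffset hp d g hρ hβ r + (weightedPrimitive hp _ hk ∘L primitive hp) v r))⁻¹) ∧
        h = primitive hp v := by
  have hprim : ∀ v : C(Icc p0 (0 : ℝ), ℝ), (∀ r, v r = (√(μ + fpeOffset hp d g hρ hβ r +
      weightedPrimitive hp _ hk h r))⁻¹) →
      ∀ p : Icc p0 (0 : ℝ), primitive hp v p = ∫ r in p0..p, fpeDeriv p0 d g μ ρ' β H r := by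
    intro v hv p
    rw [primitive_apply]
    refine intervalIntegral.integral_congr fun s hs => ?_
    rw [uIcc_of_le p.2.1] at hs
    have hs' : s ∈ Icc p0 0 := Icc_subset_Icc_right p.2.2 hs
    simp only [IccExtend_of_mem hp v hs', hv, fpeDeriv]
    rw [← fpe_radicand_eq hp hρ hβ hk hH μ ⟨s, hs'⟩]
  constructor
  · rintro ⟨-, hnn, heq⟩
    have h0 : 0 ≤ h := fun p => by simpa [hH p] using hnn p p.2
    have hpos : ∀ r, 0 < μ + fpeOffset hp d g hρ hβ r +
        weightedPrimitive hp _ hk h r := fun r => by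
      have h₁ := muStar_add_fpeOffset_nonneg hp hd hg hρ hβ r
      have h₂ : 0 ≤ weightedPrimitive hp _ hk h r :=
        weightedPrimitive_nonneg hp _ hk0 h0 r
      linarith
    let v : C(Icc p0 (0 : ℝ), ℝ) := ⟨fun r => (√(μ + fpeOffset hp d g hρ hβ r +
      weightedPrimitive hp _ hk h r))⁻¹,
      Continuous.inv₀ (by fun_prop) fun r => (Real.sqrt_pos.2 (hpos r)).ne'⟩
    have hhv : h = primitive hp v := by
      ext p
      rw [hH p, heq p p.2, hprim v (fun _ => rfl) p]
    refine ⟨v, ⟨fun r => inv_nonneg.2 (Real.sqrt_nonneg _), fun r => ?_⟩, hhv⟩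
    rw [ContinuousLinearMap.comp_apply, ← hhv]
    rfl
  · rintro ⟨v, ⟨hv0, hv⟩, rfl⟩
    have hH' : ∀ p (hp' : p ∈ Icc p0 0), H p = primitive hp v ⟨p, hp'⟩ :=
      fun p hp' => (hH ⟨p, hp'⟩).symm
    refine ⟨?_, fun p hp' => ?_, fun p hp' => ?_⟩
    · rw [continuousOn_iff_continuous_domRestrict]
      exact (primitive hp v).continuous.congr hH
    · rw [hH' p hp']
      exact primitive_nonneg hp hv0 _
    · rw [hH' p hp']
      exact hprim v hv ⟨p, hp'⟩

end FPE

/-- there is a map `𝓗 : (μ*,∞) → C([p0,0],ℝ)` such that for each `μ > μ*` the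
function `𝓗(μ)` is the unique continuous nonnegative solution of the (FPE) for `μ`, and
`μ ↦ 𝓗(μ)` is of class `C^∞` on `(μ*,∞)`. -/
theorem fpe_solution_smooth_dependence
    (p0 d g : ℝ) (ρ' β : ℝ → ℝ)
    (hp0 : p0 < 0) (hd : 0 < d) (hg : 0 < g)
    (hρint : IntegrableOn ρ' (Set.Icc p0 0))
    (hρneg : ∀ᵐ s ∂(volume.restrict (Set.Icc p0 (0:ℝ))), ρ' s ≤ 0)
    (hβint : IntegrableOn β (Set.Icc p0 0)) :
    ∃ 𝓗 : ℝ → C(Set.Icc p0 (0:ℝ), ℝ),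
      (∀ μ : ℝ, muStar p0 d g ρ' β < μ →
        ∃ H : ℝ → ℝ, IsFPESolution p0 d g μ ρ' β H ∧
          (∀ p : Set.Icc p0 (0:ℝ), 𝓗 μ p = H p) ∧
          (∀ H' : ℝ → ℝ, IsFPESolution p0 d g μ ρ' β H' →
            ∀ p ∈ Set.Icc p0 (0:ℝ), H' p = H p)) ∧
      ContDiffOn ℝ (⊤ : ℕ∞) 𝓗 (Set.Ioi (muStar p0 d g ρ' β)) := by
  have hp : p0 ≤ 0 := hp0.le
  have hk : IntegrableOn (fun s => -(2 * g) * ρ' s) (Icc p0 0) := hρint.const_mul _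
  have hk0 : ∀ᵐ s ∂volume.restrict (Icc p0 0), 0 ≤ -(2 * g) * ρ' s := by
    filter_upwards [hρneg] with s hs
    exact mul_nonneg_of_nonpos_of_nonpos (by linarith) hs
  have hC : 0 ≤ ∫ s in p0..(0 : ℝ), |-(2 * g) * ρ' s| :=
    intervalIntegral.integral_nonneg hp fun _ _ => abs_nonneg _
  have hL := lipschitzVolterra_weightedPrimitive_primitive hp hk
  have hpos : ∀ f, 0 ≤ f → 0 ≤ (weightedPrimitive hp _ hk ∘L primitive hp) f := fun f hf =>
    weightedPrimitive_nonneg hp hk hk0 (primitive_nonneg hp hf)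
  have hA := muStar_add_fpeOffset_nonneg hp hd.le hg.le hρint hβint
  choose! V hV huniq using fun μ hμ => existsUnique_nonneg_eq_inv_sqrt hC hL hpos hA (μ := μ) hμ
  refine ⟨fun μ => primitive hp (V μ), fun μ hμ =>
    ⟨IccExtend hp (primitive hp (V μ)), ?_, fun p => (IccExtend_val hp _ p).symm, ?_⟩, ?_⟩
  · exact (isFPESolution_iff hp hd.le hg.le hρint hβint hk hk0 hμ
      fun p => (IccExtend_val hp _ p).symm).2 ⟨V μ, hV μ hμ, rfl⟩
  · intro H' hH' p hp'
    obtain ⟨v, hv, hhv⟩ := (isFPESolution_iff hp hd.le hg.le hρint hβint hk hk0 hμ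
      (h := ⟨_, hH'.1.domRestrict⟩) fun _ => rfl).1 hH'
    rw [IccExtend_of_mem hp _ hp', ← huniq μ hμ v hv, ← hhv]
    rfl
  · refine (primitive hp).contDiff.comp_contDiffOn fun μ hμ => ContDiffAt.contDiffWithinAt ?_
    refine contDiffAt_of_unique_eq_inv_sqrt hC hL (fun r => ?_) (hV μ hμ).2 ?_
    · rw [(hV μ hμ).2 r]
      have h₁ : 0 ≤ (weightedPrimitive hp _ hk ∘L primitive hp) (V μ) r := hpos _ (hV μ hμ).1 r
      have h₂ : muStar p0 d g ρ' β < μ := hμ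
      exact inv_pos.2 (Real.sqrt_pos.2 (by linarith [hA r]))
    · filter_upwards [isOpen_Ioi.mem_nhds hμ] with ν hν v hv hveq
      exact huniq ν hν v ⟨hv, hveq⟩
end

section
/- Assume in addition that ρ̄ is nonincreasing on [p0,0] and that e^{2A(0)} − 2A(0) ≤ 5. Let w, z : [p0,0] → ℝ be differentiable functions satisfying, for all p ∈ [p0,0], w'(p) = (g ρ̄(p)/a(p)³) w(p) + z(p)/a(p)³ and z'(p) = −(g² ρ̄(p)²/a(p)³) w(p) − (g ρ̄(p)/a(p)³) z(p), together with the boundary conditions w(p0) = 0 and w(0) = 0. Then w ≡ 0 and z ≡ 0 on [p0,0]. -/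
open MeasureTheory Set

/-- `A(p) = ∫_{p0}^p g ρ̄(s)/a(s)³ ds`. -/
noncomputable def Afun (p0 g : ℝ) (a ρ : ℝ → ℝ) (p : ℝ) : ℝ :=
  ∫ s in p0..p, g * ρ s / (a s) ^ 3

/-- A function continuous on `[x, q]` with nonnegative derivative inside is at least its initial
value. -/
lemma le_of_hasDerivAt_nonneg {f f' : ℝ → ℝ} {x q : ℝ} (hf : ContinuousOn f (Icc x q))
    (hf' : ∀ p ∈ Ioo x q, HasDerivAt f (f' p) p) (h0 : ∀ p ∈ Ioo x q, 0 ≤ f' p)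
    {p : ℝ} (hp : p ∈ Icc x q) : f x ≤ f p := by
  have hmono : MonotoneOn f (Icc x q) := by
    refine monotoneOn_of_hasDerivWithinAt_nonneg (convex_Icc x q) hf (f' := f') ?_ ?_
    · intro p hp
      rw [interior_Icc] at hp ⊢
      exact (hf' p hp).hasDerivWithinAt
    · intro p hp
      rw [interior_Icc] at hp
      exact h0 p hp
  exact hmono (left_mem_Icc.2 (hp.1.trans hp.2)) hp hp.1

/-- The system in the variables `W = w e^{-A}`, `Z = z e^{A}`: as long as `Z` is positive,
`Z` is bounded below by an explicit function of `A`. -/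
lemma lower_bound_of_scaled_system {r h A W Z : ℝ → ℝ} {x q : ℝ} (hxq : x ≤ q)
    (hr : ∀ p ∈ Icc x q, 0 < r p) (hh : ∀ p ∈ Icc x q, 0 < h p) (hanti : AntitoneOn r (Icc x q))
    (hAc : ContinuousOn A (Icc x q)) (hWc : ContinuousOn W (Icc x q))
    (hZc : ContinuousOn Z (Icc x q))
    (hA : ∀ p ∈ Ioo x q, HasDerivAt A (r p * h p) p)
    (hW : ∀ p ∈ Ioo x q, HasDerivAt W (h p * Real.exp (-2 * A p) * Z p) p)
    (hZ : ∀ p ∈ Ioo x q, HasDerivAt Z (-(r p ^ 2 * h p * Real.exp (2 * A p) * W p)) p)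
    (hA0 : A x = 0) (hW0 : W x = 0) (hpos : ∀ p ∈ Ioo x q, 0 < Z p) :
    Z x * (5 - Real.exp (2 * A q) + 2 * A q) / 4 ≤ Z q := by
  have sub : ∀ {p}, p ∈ Ioo x q → p ∈ Icc x q := fun hp => Ioo_subset_Icc_self hp
  have hWnn : ∀ p ∈ Icc x q, 0 ≤ W p := by
    intro p hp
    rw [← hW0]
    refine le_of_hasDerivAt_nonneg hWc hW (fun s hs => ?_) hp
    have := hpos s hs
    have := hh s (sub hs)
    positivity
  have hZle : ∀ p ∈ Icc x q, Z p ≤ Z x := by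
    intro p hp
    have := le_of_hasDerivAt_nonneg hZc.neg (fun s hs => (hZ s hs).neg) (fun s hs => ?_) hp
    · simpa using this
    · have := hWnn s (sub hs)
      have := hh s (sub hs)
      rw [neg_neg]
      positivity
  have hrW : ∀ p ∈ Icc x q, r p * W p ≤ Z x * (1 - Real.exp (-2 * A p)) / 2 := by
    intro p hp
    have hsub : Icc x p ⊆ Icc x q := Icc_subset_Icc_right hp.2
    have key := le_of_hasDerivAt_nonneg (x := x) (q := p) (p := p)
      (f := fun s => Z x * (1 - Real.exp (-2 * A s)) / 2 - r p * W s)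
      (f' := fun s => h s * Real.exp (-2 * A s) * (Z x * r s - r p * Z s)) ?_ ?_ ?_
      (right_mem_Icc.2 hp.1)
    · simp only [hA0, hW0] at key
      norm_num at key
      norm_num
      linarith
    · have h1 := hAc.mono hsub
      have h2 := hWc.mono hsub
      fun_prop
    · intro s hs
      have hs' : s ∈ Ioo x q := ⟨hs.1, hs.2.trans_le hp.2⟩
      have h1 := ((((((hA s hs').const_mul (-2)).exp).const_sub 1).const_mul (Z x)).div_const 2).sub
        ((hW s hs').const_mul (r p))
      refine h1.congr_deriv ?_
      ring
    · intro s hs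
      have hs' : s ∈ Ioo x q := ⟨hs.1, hs.2.trans_le hp.2⟩
      have h1 : r p ≤ r s := hanti (sub hs') hp hs.2.le
      have h2 := hZle s (sub hs')
      have h3 := hpos s hs'
      have h4 := hr p hp
      have h5 := hh s (sub hs')
      have h6 : r p * Z s ≤ Z x * r s := by nlinarith
      have h7 := sub_nonneg.2 h6
      positivity
  have key := le_of_hasDerivAt_nonneg (x := x) (q := q) (p := q)
    (f := fun s => Z s - Z x * (5 - Real.exp (2 * A s) + 2 * A s) / 4)
    (f' := fun s => r s * h s * Real.exp (2 * A s) *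
      (Z x * (1 - Real.exp (-2 * A s)) / 2 - r s * W s)) ?_ ?_ ?_ (right_mem_Icc.2 hxq)
  · simp only [hA0] at key
    norm_num at key
    linarith
  · fun_prop
  · intro s hs
    have h1 := (hZ s hs).sub ((((((hA s hs).const_mul 2).exp).const_sub 5).add
      ((hA s hs).const_mul 2)).const_mul (Z x) |>.div_const 4)
    refine h1.congr_deriv ?_
    have : Real.exp (2 * A s) * Real.exp (-2 * A s) = 1 := by
      rw [← Real.exp_add]; simp
    linear_combination (r s * h s * Z x / 2) * this
  · intro s hs
    have h1 := sub_nonneg.2 (hrW s (sub hs))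
    have h2 := hr s (sub hs)
    have h3 := hh s (sub hs)
    positivity

/-- A solution of the first-order system starting at `w = 0` with positive `z` has `w > 0` at the
right endpoint. -/
lemma pos_of_system {r h w z : ℝ → ℝ} {x y : ℝ} (hxy : x < y)
    (hrc : ContinuousOn r (Icc x y)) (hhc : ContinuousOn h (Icc x y))
    (hr : ∀ p ∈ Icc x y, 0 < r p) (hh : ∀ p ∈ Icc x y, 0 < h p) (hanti : AntitoneOn r (Icc x y))
    (hA : Real.exp (2 * ∫ s in x..y, r s * h s) - 2 * (∫ s in x..y, r s * h s) ≤ 5)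
    (hw : ∀ p ∈ Icc x y, HasDerivWithinAt w (r p * h p * w p + h p * z p) (Icc x y) p)
    (hz : ∀ p ∈ Icc x y,
      HasDerivWithinAt z (-(r p ^ 2 * h p * w p) - r p * h p * z p) (Icc x y) p)
    (hwx : w x = 0) (hzx : 0 < z x) : 0 < w y := by
  set A : ℝ → ℝ := fun p => ∫ s in x..p, r s * h s with hAdef
  have hkc : ContinuousOn (fun s => r s * h s) (Icc x y) := hrc.mul hhc
  have hint : IntervalIntegrable (fun s => r s * h s) volume x y := by
    apply ContinuousOn.intervalIntegrable
    rwa [uIcc_of_le hxy.le]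
  have hA0 : A x = 0 := by simp [hAdef]
  have hAc : ContinuousOn A (Icc x y) := by
    have := intervalIntegral.continuousOn_primitive_interval' hint left_mem_uIcc
    rwa [uIcc_of_le hxy.le] at this
  have hAd : ∀ p ∈ Ioo x y, HasDerivAt A (r p * h p) p := by
    intro p hp
    refine intervalIntegral.integral_hasDerivAt_right (hint.mono_set ?_) ?_
      (hkc.continuousAt (Icc_mem_nhds hp.1 hp.2))
    · rw [uIcc_of_le hxy.le, uIcc_of_le hp.1.le]
      exact Icc_subset_Icc_right hp.2.le
    · exact (hkc.mono Ioo_subset_Icc_self).stronglyMeasurableAtFilter isOpen_Ioo p hp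
  have hAmono : StrictMonoOn A (Icc x y) := by
    refine strictMonoOn_of_deriv_pos (convex_Icc x y) hAc fun p hp => ?_
    rw [interior_Icc] at hp
    rw [(hAd p hp).deriv]
    exact mul_pos (hr p (Ioo_subset_Icc_self hp)) (hh p (Ioo_subset_Icc_self hp))
  have hwc : ContinuousOn w (Icc x y) := fun p hp => (hw p hp).continuousWithinAt
  have hzc : ContinuousOn z (Icc x y) := fun p hp => (hz p hp).continuousWithinAt
  set W : ℝ → ℝ := fun p => w p * Real.exp (-A p) with hWdef
  set Z : ℝ → ℝ := fun p => z p * Real.exp (A p) with hZdef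
  have hWc : ContinuousOn W (Icc x y) := by fun_prop
  have hZc : ContinuousOn Z (Icc x y) := by fun_prop
  have hWd : ∀ p ∈ Ioo x y, HasDerivAt W (h p * Real.exp (-2 * A p) * Z p) p := by
    intro p hp
    have h1 := ((hw p (Ioo_subset_Icc_self hp)).hasDerivAt (Icc_mem_nhds hp.1 hp.2)).mul
      (hAd p hp).neg.exp
    refine h1.congr_deriv ?_
    have : Real.exp (-A p) = Real.exp (-2 * A p) * Real.exp (A p) := by
      rw [← Real.exp_add]; congr 1; ring
    simp only [hZdef, Pi.neg_apply, this]
    ring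
  have hZd : ∀ p ∈ Ioo x y, HasDerivAt Z (-(r p ^ 2 * h p * Real.exp (2 * A p) * W p)) p := by
    intro p hp
    have h1 := ((hz p (Ioo_subset_Icc_self hp)).hasDerivAt (Icc_mem_nhds hp.1 hp.2)).mul
      (hAd p hp).exp
    refine h1.congr_deriv ?_
    have : Real.exp (A p) = Real.exp (2 * A p) * Real.exp (-A p) := by
      rw [← Real.exp_add]; congr 1; ring
    simp only [hWdef, this]
    ring
  have hW0 : W x = 0 := by simp [hWdef, hwx]
  have hZ0 : 0 < Z x := mul_pos hzx (Real.exp_pos _)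
  have hZpos : ∀ p ∈ Ioo x y, 0 < Z p := by
    by_contra! hneg
    obtain ⟨p, hp, hpZ⟩ := hneg
    have hcomp : IsCompact (Icc x y ∩ Z ⁻¹' Iic 0) :=
      isCompact_Icc.of_isClosed_subset (hZc.preimage_isClosed_of_isClosed isClosed_Icc isClosed_Iic)
        inter_subset_left
    obtain ⟨q, ⟨hq, hqZ⟩, hqmin⟩ := hcomp.exists_isLeast ⟨p, Ioo_subset_Icc_self hp, hpZ⟩
    have hqp : q ≤ p := hqmin ⟨Ioo_subset_Icc_self hp, hpZ⟩
    have hqy : q < y := hqp.trans_lt hp.2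
    have hsub : Icc x q ⊆ Icc x y := Icc_subset_Icc_right hq.2
    have hsub' : Ioo x q ⊆ Ioo x y := Ioo_subset_Ioo_right hq.2
    have hbound := lower_bound_of_scaled_system hq.1 (fun s hs => hr s (hsub hs))
      (fun s hs => hh s (hsub hs)) (hanti.mono hsub) (hAc.mono hsub) (hWc.mono hsub)
      (hZc.mono hsub) (fun s hs => hAd s (hsub' hs)) (fun s hs => hWd s (hsub' hs))
      (fun s hs => hZd s (hsub' hs)) hA0 hW0 (fun s hs => by
        by_contra! hs0
        exact (hqmin ⟨hsub (Ioo_subset_Icc_self hs), hs0⟩).not_gt hs.2)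
    have hAq : A q < A y := hAmono hq (right_mem_Icc.2 hxy.le) hqy
    have hAq0 : 0 ≤ A q := hA0 ▸ hAmono.monotoneOn (left_mem_Icc.2 hxy.le) hq hq.1
    have hexp : Real.exp (2 * A q) - 2 * A q < 5 := by
      have h1 := Real.add_one_le_exp (2 * A y - 2 * A q)
      have h2 : Real.exp (2 * A y) = Real.exp (2 * A q) * Real.exp (2 * A y - 2 * A q) := by
        rw [← Real.exp_add]; congr 1; ring
      have h3 := Real.add_one_le_exp (2 * A q)
      rcases hAq0.eq_or_lt with h0 | h0
      · rw [← h0]; norm_num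
      · have hA' : Real.exp (2 * A y) - 2 * A y ≤ 5 := hA
        nlinarith [mul_pos h0 (sub_pos.2 hAq), Real.exp_pos (2 * A q)]
    have hqZ' : Z q ≤ 0 := hqZ
    have : 0 < Z x * (5 - Real.exp (2 * A q) + 2 * A q) / 4 := by
      have : 0 < 5 - Real.exp (2 * A q) + 2 * A q := by linarith
      positivity
    linarith
  have hWmono : StrictMonoOn W (Icc x y) := by
    refine strictMonoOn_of_deriv_pos (convex_Icc x y) hWc fun p hp => ?_
    rw [interior_Icc] at hp
    rw [(hWd p hp).deriv]
    have := hZpos p hp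
    have := hh p (Ioo_subset_Icc_self hp)
    positivity
  have hWy : W x < W y := hWmono (left_mem_Icc.2 hxy.le) (right_mem_Icc.2 hxy.le) hxy
  rw [hW0] at hWy
  exact pos_of_mul_pos_left hWy (Real.exp_pos _).le

/-- A planar linear system with continuous coefficients and zero initial data has only the zero
solution. -/
lemma planar_linear_system_unique {α β γ δ w z : ℝ → ℝ} {x y : ℝ}
    (hα : ContinuousOn α (Icc x y)) (hβ : ContinuousOn β (Icc x y))
    (hγ : ContinuousOn γ (Icc x y)) (hδ : ContinuousOn δ (Icc x y))
    (hw : ∀ p ∈ Icc x y, HasDerivWithinAt w (α p * w p + β p * z p) (Icc x y) p)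
    (hz : ∀ p ∈ Icc x y, HasDerivWithinAt z (γ p * w p + δ p * z p) (Icc x y) p)
    (hwx : w x = 0) (hzx : z x = 0) : ∀ p ∈ Icc x y, w p = 0 ∧ z p = 0 := by
  obtain ⟨K, hK⟩ := isCompact_Icc.exists_bound_of_continuousOn
    (f := fun p => |α p| + |β p| + |γ p| + |δ p|) (s := Icc x y)
    (((hα.abs.add hβ.abs).add hγ.abs).add hδ.abs)
  have hbound := norm_le_gronwallBound_of_norm_deriv_right_le
    (f := fun p => (w p, z p)) (f' := fun p => (α p * w p + β p * z p, γ p * w p + δ p * z p))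
    (δ := 0) (K := K) (ε := 0) (a := x) (b := y) ?_ ?_ ?_ ?_
  · intro p hp
    have := hbound p hp
    rw [gronwallBound_ε0_δ0] at this
    have h0 := norm_le_zero_iff.1 this
    exact ⟨congrArg Prod.fst h0, congrArg Prod.snd h0⟩
  · exact ContinuousOn.prodMk (fun p hp => (hw p hp).continuousWithinAt)
      (fun p hp => (hz p hp).continuousWithinAt)
  · intro p hp
    have hp' := Ico_subset_Icc_self hp
    exact ((hw p hp').prodMk (hz p hp')).mono_of_mem_nhdsWithin
      (Icc_mem_nhdsGE_of_mem hp)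
  · simp [hwx, hzx]
  · intro p hp
    have hKp := (le_abs_self _).trans (hK p (Ico_subset_Icc_self hp))
    have hW : |w p| ≤ ‖(w p, z p)‖ := norm_fst_le (w p, z p)
    have hZ : |z p| ≤ ‖(w p, z p)‖ := norm_snd_le (w p, z p)
    have hN := norm_nonneg (w p, z p)
    have comb : ∀ c d : ℝ, |c| + |d| ≤ K → ‖c * w p + d * z p‖ ≤ K * ‖(w p, z p)‖ + 0 := by
      intro c d hcd
      have h1 := abs_add_le (c * w p) (d * z p)
      rw [abs_mul, abs_mul] at h1
      have h2 := mul_le_mul_of_nonneg_left hW (abs_nonneg c)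
      have h3 := mul_le_mul_of_nonneg_left hZ (abs_nonneg d)
      have h4 := mul_le_mul_of_nonneg_right hcd hN
      rw [Real.norm_eq_abs]
      linarith
    have := abs_nonneg (α p)
    have := abs_nonneg (β p)
    have := abs_nonneg (γ p)
    have := abs_nonneg (δ p)
    exact max_le (comb _ _ (by linarith)) (comb _ _ (by linarith))

/-- if `ρ̄` is nonincreasing and `e^{2A(0)} − 2A(0) ≤ 5`, then the first-order
system `w' = (gρ̄/a³)w + z/a³`, `z' = −(g²ρ̄²/a³)w − (gρ̄/a³)z` on `[p0,0]` with the Dirichlet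
conditions `w(p0) = w(0) = 0` has only the trivial solution `w ≡ 0`, `z ≡ 0`. -/
theorem dirichlet_system_trivial_solution
    (p0 g : ℝ) (hp0 : p0 < 0) (hg : 0 < g)
    (a ρ : ℝ → ℝ)
    (ha : ContinuousOn a (Set.Icc p0 0)) (hapos : ∀ p ∈ Set.Icc p0 (0:ℝ), 0 < a p)
    (hρc : ContinuousOn ρ (Set.Icc p0 0)) (hρpos : ∀ p ∈ Set.Icc p0 (0:ℝ), 0 < ρ p)
    (hρmono : AntitoneOn ρ (Set.Icc p0 0))
    (hA : Real.exp (2 * Afun p0 g a ρ 0) - 2 * Afun p0 g a ρ 0 ≤ 5)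
    (w z : ℝ → ℝ)
    (hw : ∀ p ∈ Set.Icc p0 (0:ℝ),
      HasDerivWithinAt w (g * ρ p / (a p) ^ 3 * w p + z p / (a p) ^ 3) (Set.Icc p0 0) p)
    (hz : ∀ p ∈ Set.Icc p0 (0:ℝ),
      HasDerivWithinAt z (-(g ^ 2 * (ρ p) ^ 2 / (a p) ^ 3) * w p
        - g * ρ p / (a p) ^ 3 * z p) (Set.Icc p0 0) p)
    (hwp0 : w p0 = 0) (hw0 : w 0 = 0) :
    ∀ p ∈ Set.Icc p0 (0:ℝ), w p = 0 ∧ z p = 0 := by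
  set r : ℝ → ℝ := fun p => g * ρ p with hr
  set h : ℝ → ℝ := fun p => 1 / a p ^ 3 with hh
  have hrc : ContinuousOn r (Icc p0 0) := continuousOn_const.mul hρc
  have hhc : ContinuousOn h (Icc p0 0) :=
    continuousOn_const.div (ha.pow 3) fun p hp => (pow_pos (hapos p hp) 3).ne'
  have hrpos : ∀ p ∈ Icc p0 0, 0 < r p := fun p hp => mul_pos hg (hρpos p hp)
  have hhpos : ∀ p ∈ Icc p0 0, 0 < h p := fun p hp => one_div_pos.2 (pow_pos (hapos p hp) 3)
  have hanti : AntitoneOn r (Icc p0 0) := fun p hp q hq hpq =>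
    mul_le_mul_of_nonneg_left (hρmono hp hq hpq) hg.le
  have hAeq : Afun p0 g a ρ 0 = ∫ s in p0..0, r s * h s := by
    simp only [Afun, hr, hh, mul_one_div]
  rw [hAeq] at hA
  have hw' : ∀ p ∈ Icc p0 0,
      HasDerivWithinAt w (r p * h p * w p + h p * z p) (Icc p0 0) p := fun p hp => by
    convert hw p hp using 1
    simp only [hr, hh]
    ring
  have hz' : ∀ p ∈ Icc p0 0,
      HasDerivWithinAt z (-(r p ^ 2 * h p * w p) - r p * h p * z p) (Icc p0 0) p := fun p hp => by
    convert hz p hp using 1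
    simp only [hr, hh]
    ring
  rcases lt_trichotomy (z p0) 0 with hneg | hzero | hpos
  · have := pos_of_system (w := fun p => -w p) (z := fun p => -z p) hp0 hrc hhc hrpos hhpos hanti hA
      (fun p hp => (hw' p hp).fun_neg.congr_deriv (by ring))
      (fun p hp => (hz' p hp).fun_neg.congr_deriv (by ring))
      (by simp [hwp0]) (by simpa using hneg)
    simp [hw0] at this
  · exact planar_linear_system_unique (α := fun p => r p * h p) (β := h)
      (γ := fun p => -(r p ^ 2 * h p)) (δ := fun p => -(r p * h p))
      (hrc.mul hhc) hhc ((hrc.pow 2).mul hhc).neg (hrc.mul hhc).neg hw'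
      (fun p hp => by convert hz' p hp using 1; ring) hwp0 hzero
  · have := pos_of_system hp0 hrc hhc hrpos hhpos hanti hA hw' hz' hwp0 hpos
    exact absurd hw0 this.ne'
end

section
/- Let x* denote the unique positive solution of e^x − x = 5. Assume μ* − 2 min_{[p0,0]} B > 0, p0² − (μ* − 2 min_{[p0,0]} B) d² > 0, and the size condition g d³ ρ̄(p0) |p0| ≤ (x*/2) · (p0² − (μ* − 2 min_{[p0,0]} B) d²)^{3/2}. Let μ > μ* and let H : [p0,0] → [0,∞) be a continuous solution of the fixed-point equation (FPE) for μ with H(0) = d (so H is differentiable with H' > 0). Then: (i) 1/H'(p)² ≥ p0²/d² − (μ* − 2 min_{[p0,0]} B) for all p ∈ [p0,0]; (ii) the number A(0) := ∫_{p0}^0 g ρ̄(s) H'(s)³ ds satisfies A(0) ≤ x*/2 and e^{2A(0)} − 2A(0) ≤ 5. -/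
open MeasureTheory Set

lemma integral_density_forcing_bounds {a b c : ℝ} (hc : 0 ≤ c) {d : ℝ} {φ β H : ℝ → ℝ}
    (hφ : IntegrableOn φ (Icc a b))
    (hφneg : ∀ᵐ s ∂(volume.restrict (Icc a b)), φ s ≤ 0)
    (hβ : IntegrableOn β (Icc a b)) (hH : ContinuousOn H (Icc a b))
    (hH0 : ∀ s ∈ Icc a b, 0 ≤ H s) (hHd : ∀ s ∈ Icc a b, H s ≤ d) {r : ℝ} (hr : r ∈ Icc a b) :
    (∫ s in a..r, β s) ≤ ∫ s in a..r, (c * φ s * (H s - d) + β s) ∧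
    (∫ s in a..r, (c * φ s * (H s - d) + β s)) ≤
      c * d * (∫ s in a..b, |φ s|) + ∫ s in a..r, β s := by
  have hsub : Icc a r ⊆ Icc a b := Icc_subset_Icc_right hr.2
  have hd : 0 ≤ d := (hH0 r hr).trans (hHd r hr)
  have hprod : IntegrableOn (fun s => c * φ s * (H s - d)) (Icc a b) :=
    IntegrableOn.mul_continuousOn (hφ.const_mul c) (hH.sub continuousOn_const) isCompact_Icc
  have iprod : IntervalIntegrable (fun s => c * φ s * (H s - d)) volume a r :=
    (intervalIntegrable_iff_integrableOn_Icc_of_le hr.1).2 (hprod.mono_set hsub)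
  have iβ : IntervalIntegrable β volume a r :=
    (intervalIntegrable_iff_integrableOn_Icc_of_le hr.1).2 (hβ.mono_set hsub)
  have habs : IntegrableOn (fun s => c * d * |φ s|) (Icc a b) := hφ.abs.const_mul (c * d)
  have iabs : IntervalIntegrable (fun s => c * d * |φ s|) volume a b :=
    (intervalIntegrable_iff_integrableOn_Icc_of_le (hr.1.trans hr.2)).2 habs
  have iabs' : IntervalIntegrable (fun s => c * d * |φ s|) volume a r :=
    (intervalIntegrable_iff_integrableOn_Icc_of_le hr.1).2 (habs.mono_set hsub)
  have hpt : ∀ᵐ s ∂(volume.restrict (Icc a r)),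
      0 ≤ c * φ s * (H s - d) ∧ c * φ s * (H s - d) ≤ c * d * |φ s| := by
    filter_upwards [ae_restrict_of_ae_restrict_of_subset hsub hφneg,
      ae_restrict_mem measurableSet_Icc] with s hs hmem
    have h0 := hH0 s (hsub hmem)
    have h1 := hHd s (hsub hmem)
    have hcφ : 0 ≤ c * -φ s := mul_nonneg hc (by linarith)
    rw [abs_of_nonpos hs]
    constructor <;> nlinarith
  have hlow : 0 ≤ ∫ s in a..r, c * φ s * (H s - d) :=
    intervalIntegral.integral_nonneg_of_ae_restrict hr.1 (hpt.mono fun s hs => hs.1)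
  have hup : (∫ s in a..r, c * φ s * (H s - d)) ≤ ∫ s in a..r, c * d * |φ s| :=
    intervalIntegral.integral_mono_ae_restrict hr.1 iprod iabs' (hpt.mono fun s hs => hs.2)
  have hext : (∫ s in a..r, c * d * |φ s|) ≤ ∫ s in a..b, c * d * |φ s| :=
    intervalIntegral.integral_mono_interval le_rfl hr.1 hr.2
      (Filter.Eventually.of_forall fun s => by positivity) iabs
  rw [intervalIntegral.integral_const_mul (c * d) (fun s => |φ s|) (a := a) (b := b)] at hext
  rw [intervalIntegral.integral_add iprod iβ]
  constructor <;> linarith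

lemma continuousOn_primitive_Icc {a b : ℝ} (hab : a ≤ b) {f : ℝ → ℝ}
    (hf : IntegrableOn f (Icc a b)) : ContinuousOn (fun r => ∫ s in a..r, f s) (Icc a b) := by
  rw [← uIcc_of_le hab] at hf ⊢
  exact intervalIntegral.continuousOn_primitive_interval hf

lemma eq_of_hasDerivWithinAt_primitive {a b : ℝ} (hab : a < b) {f F F' : ℝ → ℝ}
    (hf : ContinuousOn f (Icc a b)) (hF : ∀ p ∈ Icc a b, F p = ∫ r in a..p, f r)
    (hF' : ∀ p ∈ Icc a b, HasDerivWithinAt F (F' p) (Icc a b) p) {p : ℝ} (hp : p ∈ Icc a b) :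
    F' p = f p := by
  have : Fact (p ∈ Icc a b) := ⟨hp⟩
  have hint : IntervalIntegrable f volume a p :=
    (hf.mono (by rw [uIcc_of_le hp.1]; exact Icc_subset_Icc_right hp.2)).intervalIntegrable
  have h : HasDerivWithinAt (fun u => ∫ r in a..u, f r) (f p) (Icc a b) p :=
    intervalIntegral.integral_hasDerivWithinAt_right hint
      (hf.stronglyMeasurableAtFilter_nhdsWithin measurableSet_Icc p) (hf p hp)
  exact (uniqueDiffOn_Icc hab p hp).eq_deriv _ (hF' p hp) (h.congr_of_mem hF hp)

lemma cube_le_chord {l h u : ℝ} (hl : 0 ≤ l) (hlh : l ≤ h) (hhu : h ≤ u) :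
    h ^ 3 ≤ l ^ 3 + (h - l) * (u ^ 2 + u * l + l ^ 2) := by
  have h1 : h ^ 2 ≤ u ^ 2 := pow_le_pow_left₀ (hl.trans hlh) hhu 2
  have h2 : h * l ≤ u * l := mul_le_mul_of_nonneg_right hhu hl
  nlinarith [mul_nonneg (sub_nonneg.2 hlh) (by linarith :
    0 ≤ u ^ 2 + u * l + l ^ 2 - (h ^ 2 + h * l + l ^ 2))]

lemma chord_mean_le_three {l u : ℝ} (hl : 0 ≤ l) (hl1 : l ≤ 1) (hu1 : 1 ≤ u)
    (h : u ^ 2 - l ^ 2 ≤ l ^ 2 * u ^ 2) :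
    l ^ 3 + (1 - l) * (u ^ 2 + u * l + l ^ 2) ≤ 3 := by
  have h1 : (1 - l) * u ^ 2 ≤ l ^ 2 := by
    nlinarith [mul_nonneg (mul_nonneg (sub_nonneg.2 hl1) hl) (sq_nonneg u)]
  have h2 : (1 - l) * (u * l) ≤ (1 - l) * u ^ 2 :=
    mul_le_mul_of_nonneg_left (by nlinarith) (sub_nonneg.2 hl1)
  nlinarith

lemma chord_integral_le {P d l u M : ℝ} (hP : 0 < P) (hd : 0 < d) (hl : 0 < l)
    (hlP : l * P ≤ d) (huP : d ≤ u * P) (hgap : 1 / l ^ 2 - 1 / u ^ 2 ≤ M)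
    (hM : M * d ^ 2 ≤ P ^ 2) :
    (l ^ 3 * P + (d - l * P) * (u ^ 2 + u * l + l ^ 2)) * P ^ 2 ≤ 3 * d ^ 3 := by
  have hu : 0 < u := pos_of_mul_pos_left (hd.trans_le huP) hP.le
  have hgap' : u ^ 2 - l ^ 2 ≤ M * (l ^ 2 * u ^ 2) := by
    have := mul_le_mul_of_nonneg_right hgap (by positivity : 0 ≤ l ^ 2 * u ^ 2)
    have e : (1 / l ^ 2 - 1 / u ^ 2) * (l ^ 2 * u ^ 2) = u ^ 2 - l ^ 2 := by field_simp
    linarith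
  have key := chord_mean_le_three (l := l * P / d) (u := u * P / d) (by positivity)
    ((div_le_one hd).2 hlP) ((one_le_div hd).2 huP) (by
      have : (u ^ 2 - l ^ 2) * d ^ 2 ≤ P ^ 2 * (l ^ 2 * u ^ 2) := by
        nlinarith [mul_le_mul_of_nonneg_right hgap' (sq_nonneg d),
          mul_le_mul_of_nonneg_right hM (by positivity : 0 ≤ l ^ 2 * u ^ 2)]
      have e1 : (u * P / d) ^ 2 - (l * P / d) ^ 2 =
          (u ^ 2 - l ^ 2) * d ^ 2 * (P ^ 2 / d ^ 4) := by field_simp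
      have e2 : (l * P / d) ^ 2 * (u * P / d) ^ 2 =
          P ^ 2 * (l ^ 2 * u ^ 2) * (P ^ 2 / d ^ 4) := by field_simp
      rw [e1, e2]
      exact mul_le_mul_of_nonneg_right this (by positivity))
  have e : (l ^ 3 * P + (d - l * P) * (u ^ 2 + u * l + l ^ 2)) * P ^ 2 =
      ((l * P / d) ^ 3 + (1 - l * P / d) *
        ((u * P / d) ^ 2 + u * P / d * (l * P / d) + (l * P / d) ^ 2)) * d ^ 3 := by
    field_simp
  rw [e]
  exact mul_le_mul_of_nonneg_right key (by positivity)

lemma exp_sub_self_le_five {x y : ℝ} (hx : Real.exp x - x = 5) (hyx : y ≤ x) (hy : -4 ≤ y) :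
    Real.exp y - y ≤ 5 := by
  rcases le_total y 0 with h | h
  · have := Real.exp_le_one_iff.2 h
    linarith
  · have h1 := Real.add_one_le_exp (x - y)
    have h2 := Real.one_le_exp h
    have h3 : Real.exp x = Real.exp y * Real.exp (x - y) := by rw [← Real.exp_add]; ring_nf
    nlinarith [mul_nonneg (sub_nonneg.2 h2) (sub_nonneg.2 hyx),
      mul_le_mul_of_nonneg_left h1 (Real.exp_pos y).le]

lemma pow_three_le_div_rpow {h d K : ℝ} (hh : 0 < h) (hd : 0 < d) (hK : 0 < K)
    (hle : K / d ^ 2 ≤ 1 / h ^ 2) : h ^ 3 ≤ d ^ 3 / K ^ ((3 : ℝ) / 2) := by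
  have hsq : K ^ ((3 : ℝ) / 2) = √K ^ 3 := by
    rw [Real.sqrt_eq_rpow, ← Real.rpow_mul_natCast hK.le]
    norm_num
  have hs : 0 < √K := Real.sqrt_pos.2 hK
  have h1 : h * √K ≤ d := by
    refine le_of_sq_le_sq ?_ hd.le
    rw [mul_pow, Real.sq_sqrt hK.le]
    rw [div_le_div_iff₀ (by positivity) (by positivity)] at hle
    linarith
  rw [hsq, le_div_iff₀ (by positivity), ← mul_pow]
  exact pow_le_pow_left₀ (by positivity) h1 3

/-- under the size condition (RES3) expressed with the unique positive solution
`x*` of `e^x − x = 5`, every (FPE) solution `H` (for `μ > μ*`) with `H(0) = d` satisfies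
(i) `1/H'(p)² ≥ p0²/d² − (μ* − 2 min B)` on `[p0,0]` and (ii) `A(0) = ∫_{p0}^0 g ρ̄ (H')³`
satisfies `A(0) ≤ x*/2` and `e^{2A(0)} − 2A(0) ≤ 5`. -/
theorem size_condition_implies_exp_condition
    (p0 d g : ℝ) (ρ' β : ℝ → ℝ)
    (hp0 : p0 < 0) (hd : 0 < d) (hg : 0 < g)
    (hρint : IntegrableOn ρ' (Set.Icc p0 0))
    (hρneg : ∀ᵐ s ∂(volume.restrict (Set.Icc p0 (0:ℝ))), ρ' s ≤ 0)
    (hβint : IntegrableOn β (Set.Icc p0 0))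
    (ρbar : ℝ → ℝ)
    (hρbar : ∀ p ∈ Set.Icc p0 (0:ℝ), ρbar p = ρbar p0 + ∫ s in p0..p, ρ' s)
    (hρbarp0 : 0 < ρbar p0)
    (xstar : ℝ) (hxpos : 0 < xstar) (hxeq : Real.exp xstar - xstar = 5)
    (hmin : 0 < muStar p0 d g ρ' β - 2 * sInf (Bfun p0 β '' Set.Icc p0 0))
    (hpos2 : 0 < p0 ^ 2 - (muStar p0 d g ρ' β - 2 * sInf (Bfun p0 β '' Set.Icc p0 0)) * d ^ 2)
    (hsize : g * d ^ 3 * ρbar p0 * |p0| ≤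
      xstar / 2 *
        (p0 ^ 2 - (muStar p0 d g ρ' β - 2 * sInf (Bfun p0 β '' Set.Icc p0 0)) * d ^ 2)
          ^ ((3 : ℝ) / 2))
    (μ : ℝ) (hμ : muStar p0 d g ρ' β < μ)
    (H : ℝ → ℝ) (hH : IsFPESolution p0 d g μ ρ' β H) (hH0 : H 0 = d)
    (H' : ℝ → ℝ)
    (hderiv : ∀ p ∈ Set.Icc p0 (0:ℝ), HasDerivWithinAt H (H' p) (Set.Icc p0 0) p)
    (hH'pos : ∀ p ∈ Set.Icc p0 (0:ℝ), 0 < H' p) :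
    (∀ p ∈ Set.Icc p0 (0:ℝ),
      p0 ^ 2 / d ^ 2 - (muStar p0 d g ρ' β - 2 * sInf (Bfun p0 β '' Set.Icc p0 0)) ≤
        1 / (H' p) ^ 2) ∧
    (∫ s in p0..(0:ℝ), g * ρbar s * (H' s) ^ 3) ≤ xstar / 2 ∧
    Real.exp (2 * ∫ s in p0..(0:ℝ), g * ρbar s * (H' s) ^ 3) -
        2 * ∫ s in p0..(0:ℝ), g * ρbar s * (H' s) ^ 3 ≤ 5 := by
  obtain ⟨hHc, hHnn, hHeq⟩ := hH
  have h0mem : (0 : ℝ) ∈ Icc p0 0 := ⟨hp0.le, le_rfl⟩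
  have hp0mem : p0 ∈ Icc p0 (0 : ℝ) := ⟨le_rfl, hp0.le⟩
  have hBc : ContinuousOn (Bfun p0 β) (Icc p0 0) := continuousOn_primitive_Icc hp0.le hβint
  have hBimg := isCompact_Icc.image_of_continuousOn hBc
  have hBsup : ∀ p ∈ Icc p0 (0 : ℝ), Bfun p0 β p ≤ sSup (Bfun p0 β '' Icc p0 0) :=
    fun p hp => le_csSup hBimg.bddAbove (mem_image_of_mem _ hp)
  have hBinf : ∀ p ∈ Icc p0 (0 : ℝ), sInf (Bfun p0 β '' Icc p0 0) ≤ Bfun p0 β p :=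
    fun p hp => csInf_le hBimg.bddBelow (mem_image_of_mem _ hp)
  have hmono : MonotoneOn H (Icc p0 0) :=
    monotoneOn_of_hasDerivWithinAt_nonneg (convex_Icc _ _) hHc
      (fun x hx => (hderiv x (interior_subset hx)).mono interior_subset)
      (fun x hx => (hH'pos x (interior_subset hx)).le)
  have hHd : ∀ s ∈ Icc p0 (0 : ℝ), H s ≤ d := fun s hs => hH0 ▸ hmono hs h0mem hs.2
  have hforce : IntegrableOn (fun s => g * ρ' s * (H s - d) + β s) (Icc p0 0) :=
    (IntegrableOn.mul_continuousOn (hρint.const_mul g) (hHc.sub continuousOn_const)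
      isCompact_Icc).add hβint
  have hmuStar : muStar p0 d g ρ' β =
    2 * (g * d * (∫ s in p0..(0:ℝ), |ρ' s|) + sSup (Bfun p0 β '' Icc p0 0)) := rfl
  set m := sInf (Bfun p0 β '' Icc p0 0)
  set S := sSup (Bfun p0 β '' Icc p0 0)
  set R := ∫ s in p0..(0:ℝ), |ρ' s|
  set ν := muStar p0 d g ρ' β
  set Q : ℝ → ℝ := fun r => μ - 2 * ∫ s in p0..r, (g * ρ' s * (H s - d) + β s) with hQ
  have hQc : ContinuousOn Q (Icc p0 0) :=
    continuousOn_const.sub (continuousOn_const.mul (continuousOn_primitive_Icc hp0.le hforce))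
  have hQbd : ∀ r ∈ Icc p0 (0 : ℝ), μ - ν ≤ Q r ∧ Q r ≤ μ - 2 * m := by
    intro r hr
    have h := integral_density_forcing_bounds hg.le hρint hρneg hβint hHc hHnn hHd hr
    have h1 : Bfun p0 β r ≤ S := hBsup r hr
    have h2 : m ≤ Bfun p0 β r := hBinf r hr
    simp only [Bfun] at h1 h2
    simp only [hQ]
    constructor <;> linarith [h.1, h.2]
  have hQpos : ∀ r ∈ Icc p0 (0 : ℝ), 0 < Q r := fun r hr => by linarith [(hQbd r hr).1]
  have hfc : ContinuousOn (fun r => (√(Q r))⁻¹) (Icc p0 0) :=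
    hQc.sqrt.inv₀ fun r hr => (Real.sqrt_pos.2 (hQpos r hr)).ne'
  have hH'eq : ∀ p ∈ Icc p0 (0 : ℝ), H' p = (√(Q p))⁻¹ := fun p hp =>
    eq_of_hasDerivWithinAt_primitive hp0 hfc hHeq hderiv hp
  have hH'sq : ∀ p ∈ Icc p0 (0 : ℝ), 1 / H' p ^ 2 = Q p := fun p hp => by
    rw [hH'eq p hp, inv_pow, Real.sq_sqrt (hQpos p hp).le, one_div, inv_inv]
  have hH'c : ContinuousOn H' (Icc p0 0) := hfc.congr hH'eq
  have hH'int : IntervalIntegrable H' volume p0 0 :=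
    (uIcc_of_le hp0.le ▸ hH'c).intervalIntegrable
  have hH'd : ∫ s in p0..(0:ℝ), H' s = d := by
    rw [← hH0, hHeq 0 h0mem]
    refine intervalIntegral.integral_congr fun s hs => ?_
    rw [uIcc_of_le hp0.le] at hs
    exact hH'eq s hs
  set l := (√(μ - 2 * m))⁻¹ with hl_def
  set u := (√(μ - ν))⁻¹ with hu_def
  have hUpos : 0 < μ - ν := sub_pos.2 hμ
  have hLpos : 0 < μ - 2 * m := by linarith
  have hl : 0 < l := inv_pos.2 (Real.sqrt_pos.2 hLpos)
  have hlsq : 1 / l ^ 2 = μ - 2 * m := by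
    rw [hl_def, inv_pow, Real.sq_sqrt hLpos.le, one_div, inv_inv]
  have husq : 1 / u ^ 2 = μ - ν := by
    rw [hu_def, inv_pow, Real.sq_sqrt hUpos.le, one_div, inv_inv]
  have hlH : ∀ p ∈ Icc p0 (0 : ℝ), l ≤ H' p := fun p hp => by
    rw [hH'eq p hp]
    exact inv_anti₀ (Real.sqrt_pos.2 (hQpos p hp)) (Real.sqrt_le_sqrt (hQbd p hp).2)
  have hHu : ∀ p ∈ Icc p0 (0 : ℝ), H' p ≤ u := fun p hp => by
    rw [hH'eq p hp]
    exact inv_anti₀ (Real.sqrt_pos.2 hUpos) (Real.sqrt_le_sqrt (hQbd p hp).1)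
  have hlP : l * (-p0) ≤ d := by
    have := intervalIntegral.integral_mono_on hp0.le intervalIntegrable_const hH'int hlH
    rw [hH'd, intervalIntegral.integral_const, smul_eq_mul] at this
    linarith
  have huP : d ≤ u * (-p0) := by
    have := intervalIntegral.integral_mono_on hp0.le hH'int intervalIntegrable_const hHu
    rw [hH'd, intervalIntegral.integral_const, smul_eq_mul] at this
    linarith
  have hlow : p0 ^ 2 / d ^ 2 ≤ μ - 2 * m := by
    rw [← hlsq, div_le_div_iff₀ (by positivity) (by positivity)]
    have := pow_le_pow_left₀ (mul_nonneg hl.le (by linarith)) hlP 2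
    linarith
  have hi : ∀ p ∈ Icc p0 (0:ℝ), p0 ^ 2 / d ^ 2 - (ν - 2 * m) ≤ 1 / (H' p) ^ 2 := fun p hp => by
    rw [hH'sq p hp]
    linarith [(hQbd p hp).1]
  have hR : 0 ≤ R := intervalIntegral.integral_nonneg hp0.le fun s _ => abs_nonneg _
  have hgR : g * R * d ^ 3 ≤ p0 ^ 2 / 2 := by
    have hmS : m ≤ S := (hBinf 0 h0mem).trans (hBsup 0 h0mem)
    nlinarith [mul_nonneg (sub_nonneg.2 hmS) (sq_nonneg d)]
  have hρle : ∀ s ∈ Icc p0 (0 : ℝ), ρbar s ≤ ρbar p0 := fun s hs => by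
    have h := intervalIntegral.integral_nonneg_of_ae_restrict (f := fun t => -ρ' t) hs.1
      ((ae_restrict_of_ae_restrict_of_subset (Icc_subset_Icc_right hs.2) hρneg).mono
        fun t ht => neg_nonneg.2 ht)
    rw [intervalIntegral.integral_neg] at h
    linarith [hρbar s hs]
  have hρge : ∀ s ∈ Icc p0 (0 : ℝ), -R ≤ ρbar s := fun s hs => by
    have h1 := intervalIntegral.abs_integral_le_integral_abs (f := ρ') (μ := volume) hs.1
    have h2 : (∫ t in p0..s, |ρ' t|) ≤ R :=
      intervalIntegral.integral_mono_interval le_rfl hs.1 hs.2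
        (Filter.Eventually.of_forall fun t => abs_nonneg _)
        ((intervalIntegrable_iff_integrableOn_Icc_of_le hp0.le).2 hρint.abs)
    linarith [hρbar s hs, neg_abs_le (∫ t in p0..s, ρ' t)]
  have hρc : ContinuousOn ρbar (Icc p0 0) :=
    (continuousOn_const.add (continuousOn_primitive_Icc hp0.le hρint)).congr hρbar
  have hAint : IntervalIntegrable (fun s => g * ρbar s * H' s ^ 3) volume p0 0 :=
    (uIcc_of_le hp0.le ▸ (continuousOn_const.mul hρc).mul (hH'c.pow 3)).intervalIntegrable
  have hAup : (∫ s in p0..(0:ℝ), g * ρbar s * (H' s) ^ 3) ≤ xstar / 2 := by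
    set K := p0 ^ 2 - (ν - 2 * m) * d ^ 2
    have hKd : K / d ^ 2 = p0 ^ 2 / d ^ 2 - (ν - 2 * m) := by
      simp only [K]
      field_simp
    have hKp : 0 < K ^ ((3 : ℝ) / 2) := Real.rpow_pos_of_pos hpos2 _
    have h := intervalIntegral.integral_mono_on hp0.le hAint
      (intervalIntegrable_const (c := g * ρbar p0 * (d ^ 3 / K ^ ((3 : ℝ) / 2)))) fun s hs => by
        have h3 := pow_three_le_div_rpow (hH'pos s hs) hd hpos2 (hKd ▸ hi s hs)
        have h4 := pow_pos (hH'pos s hs) 3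
        calc g * ρbar s * H' s ^ 3 ≤ g * ρbar p0 * H' s ^ 3 := by gcongr; exact hρle s hs
          _ ≤ _ := by gcongr
    refine h.trans ?_
    rw [intervalIntegral.integral_const, smul_eq_mul, mul_div_assoc', mul_div_assoc',
      div_le_iff₀ hKp]
    rw [abs_of_neg hp0] at hsize
    linarith
  have hAlow : -2 ≤ ∫ s in p0..(0:ℝ), g * ρbar s * (H' s) ^ 3 := by
    set c := u ^ 2 + u * l + l ^ 2 with hc
    have hchord : IntervalIntegrable (fun s => l ^ 3 + (H' s - l) * c) volume p0 0 :=
      intervalIntegrable_const.add ((hH'int.sub intervalIntegrable_const).mul_const c)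
    have h := intervalIntegral.integral_mono_on hp0.le (hchord.const_mul (-(g * R))) hAint
      fun s hs => by
        have h3 := cube_le_chord hl.le (hlH s hs) (hHu s hs)
        have h4 := pow_pos (hH'pos s hs) 3
        have h5 := mul_le_mul_of_nonneg_left h3 (mul_nonneg hg.le hR)
        have h6 := mul_le_mul_of_nonneg_left (hρge s hs) (mul_nonneg hg.le h4.le)
        linarith
    have hval : (∫ s in p0..(0:ℝ), l ^ 3 + (H' s - l) * c) =
        l ^ 3 * (-p0) + (d - l * (-p0)) * c := by
      rw [intervalIntegral.integral_add intervalIntegrable_const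
          ((hH'int.sub intervalIntegrable_const).mul_const c),
        intervalIntegral.integral_mul_const,
        intervalIntegral.integral_sub hH'int intervalIntegrable_const, hH'd]
      simp only [intervalIntegral.integral_const, smul_eq_mul]
      ring
    rw [intervalIntegral.integral_const_mul, hval] at h
    have hT := chord_integral_le (P := -p0) (M := ν - 2 * m) (by linarith) hd hl hlP huP
      (by rw [hlsq, husq]; linarith) (by linarith)
    rw [← hc] at hT
    set T := l ^ 3 * (-p0) + (d - l * (-p0)) * c
    have hp2 : 0 < p0 ^ 2 := sq_pos_of_neg hp0
    have h7 := mul_le_mul_of_nonneg_left hT (mul_nonneg hg.le hR)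
    have h8 : g * R * T ≤ 2 := by
      refine le_of_mul_le_mul_right ?_ hp2
      linarith
    linarith
  exact ⟨hi, hAup, exp_sub_self_le_five hxeq (by linarith) (by linarith)⟩
end

section
/- Assume in addition that ρ̄ is nonincreasing on [p0,0] and that e^{2A(0)} − 2A(0) ≤ 5. Let λ > 0, take θ = 0, and let (w, z) be the solution of the system S(λ,0) on [p0,0] with initial data w(p0) = 0 and z(p0) = a(p0)³ (equivalently w'(p0) = 1). Then z(p) > 0 and w'(p) > 0 for all p ∈ [p0,0], and w(p) > 0 for all p ∈ (p0,0]. -/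
open MeasureTheory Set

/-- A pair of differentiable functions `(w,z)` on `[p0,0]` solving the first-order system
`S(λ,θ)`: `w' = (gρ̄/a³)w + z/a³` and `z' = (θa/λ² − g²ρ̄²/a³)w − (gρ̄/a³)z`. -/
def IsSolS (p0 g lam θ : ℝ) (a ρ w z : ℝ → ℝ) : Prop :=
  ∀ p ∈ Set.Icc p0 (0:ℝ),
    HasDerivWithinAt w (g * ρ p / (a p) ^ 3 * w p + z p / (a p) ^ 3) (Set.Icc p0 0) p ∧
    HasDerivWithinAt z ((θ * a p / lam ^ 2 - g ^ 2 * (ρ p) ^ 2 / (a p) ^ 3) * w p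
      - g * ρ p / (a p) ^ 3 * z p) (Set.Icc p0 0) p

lemma lt_one_of_exp_two_mul_sub_le_five {x : ℝ} (h : Real.exp (2 * x) - 2 * x ≤ 5) : x < 1 := by
  by_contra! hx
  have h1 : Real.exp (2 * x) = Real.exp 1 * Real.exp 1 * Real.exp (2 * x - 2) := by
    rw [← Real.exp_add, ← Real.exp_add]; ring_nf
  have h2 := Real.add_one_le_exp (2 * x - 2)
  have h3 : (7.25 : ℝ) ≤ Real.exp 1 * Real.exp 1 := by
    nlinarith [Real.exp_one_gt_d9]
  have h4 : 7.25 * (2 * x - 1) ≤ Real.exp (2 * x) := by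
    rw [h1]
    exact mul_le_mul h3 (by linarith) (by linarith) (by positivity)
  linarith

section Afun

variable {p0 g : ℝ} {a ρ : ℝ → ℝ}

lemma continuousOn_Afun_integrand (ha : ContinuousOn a (Icc p0 0))
    (hapos : ∀ p ∈ Icc p0 (0 : ℝ), 0 < a p) (hρ : ContinuousOn ρ (Icc p0 0)) :
    ContinuousOn (fun s => g * ρ s / (a s) ^ 3) (Icc p0 0) :=
  (continuousOn_const.mul hρ).div (ha.pow 3) fun p hp => (pow_pos (hapos p hp) 3).ne'

lemma continuousOn_Afun (hp0 : p0 ≤ 0) (ha : ContinuousOn a (Icc p0 0))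
    (hapos : ∀ p ∈ Icc p0 (0 : ℝ), 0 < a p) (hρ : ContinuousOn ρ (Icc p0 0)) :
    ContinuousOn (Afun p0 g a ρ) (Icc p0 0) := by
  have h := intervalIntegral.continuousOn_primitive_interval (μ := volume)
    (f := fun s => g * ρ s / (a s) ^ 3) (a := p0) (b := 0)
  rw [uIcc_of_le hp0] at h
  exact h (continuousOn_Afun_integrand ha hapos hρ).integrableOn_Icc

lemma hasDerivAt_Afun (ha : ContinuousOn a (Icc p0 0))
    (hapos : ∀ p ∈ Icc p0 (0 : ℝ), 0 < a p) (hρ : ContinuousOn ρ (Icc p0 0))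
    {p : ℝ} (hp : p ∈ Ioo p0 0) :
    HasDerivAt (Afun p0 g a ρ) (g * ρ p / (a p) ^ 3) p := by
  have hc : ContinuousOn (fun s => g * ρ s / (a s) ^ 3) (Icc p0 0) :=
    continuousOn_Afun_integrand ha hapos hρ
  refine intervalIntegral.integral_hasDerivAt_right ?_ ?_
    (hc.continuousAt (Icc_mem_nhds hp.1 hp.2))
  · exact (hc.mono (Icc_subset_Icc_right hp.2.le)).intervalIntegrable_of_Icc hp.1.le
  · exact (hc.mono Ioo_subset_Icc_self).stronglyMeasurableAtFilter isOpen_Ioo p hp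

end Afun

section Solution

variable {p0 g lam : ℝ} {a ρ w z : ℝ → ℝ}

lemma IsSolS.continuousOn_fst {θ : ℝ} (hs : IsSolS p0 g lam θ a ρ w z) :
    ContinuousOn w (Icc p0 0) :=
  fun p hp => (hs p hp).1.continuousWithinAt

lemma IsSolS.continuousOn_snd {θ : ℝ} (hs : IsSolS p0 g lam θ a ρ w z) :
    ContinuousOn z (Icc p0 0) :=
  fun p hp => (hs p hp).2.continuousWithinAt

lemma IsSolS.hasDerivAt_fst {θ : ℝ} (hs : IsSolS p0 g lam θ a ρ w z) {p : ℝ}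
    (hp : p ∈ Ioo p0 0) :
    HasDerivAt w (g * ρ p / (a p) ^ 3 * w p + z p / (a p) ^ 3) p :=
  (hs p (Ioo_subset_Icc_self hp)).1.hasDerivAt (Icc_mem_nhds hp.1 hp.2)

/-- For `θ = 0` the derivative of `z` is `-g ρ` times that of `w`. -/
lemma IsSolS.hasDerivAt_snd_of_zero (hs : IsSolS p0 g lam 0 a ρ w z) {p : ℝ}
    (hp : p ∈ Ioo p0 0) :
    HasDerivAt z (-(g * ρ p) * (g * ρ p / (a p) ^ 3 * w p + z p / (a p) ^ 3)) p := by
  refine ((hs p (Ioo_subset_Icc_self hp)).2.hasDerivAt (Icc_mem_nhds hp.1 hp.2)).congr_deriv ?_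
  ring

/-- `w` stays positive as long as `z` does, because `(e^{-A} w)' = e^{-A} z / a³`. -/
lemma IsSolS.fst_pos {θ : ℝ} (hs : IsSolS p0 g lam θ a ρ w z) (ha : ContinuousOn a (Icc p0 0))
    (hapos : ∀ p ∈ Icc p0 (0 : ℝ), 0 < a p) (hρ : ContinuousOn ρ (Icc p0 0))
    (hw0 : w p0 = 0) {T : ℝ} (hT : T ∈ Ioc p0 0) (hz : ∀ p ∈ Ioo p0 T, 0 < z p) :
    0 < w T := by
  have hsub : Icc p0 T ⊆ Icc p0 0 := Icc_subset_Icc_right hT.2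
  have hcont : ContinuousOn (fun p => Real.exp (-Afun p0 g a ρ p) * w p) (Icc p0 T) :=
    ((continuousOn_Afun (hT.1.le.trans hT.2) ha hapos hρ).neg.rexp.mul
      hs.continuousOn_fst).mono hsub
  have hmono : StrictMonoOn (fun p => Real.exp (-Afun p0 g a ρ p) * w p) (Icc p0 T) := by
    refine strictMonoOn_of_deriv_pos (convex_Icc _ _) hcont fun p hp => ?_
    rw [interior_Icc] at hp
    have hp' : p ∈ Ioo p0 0 := ⟨hp.1, hp.2.trans_le hT.2⟩
    have hd := (hasDerivAt_Afun (g := g) ha hapos hρ hp').neg.exp.mul (hs.hasDerivAt_fst hp')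
    have hpos : 0 < Real.exp (-Afun p0 g a ρ p) * (z p / (a p) ^ 3) :=
      mul_pos (Real.exp_pos _)
        (div_pos (hz p hp) (pow_pos (hapos p (Ioo_subset_Icc_self hp')) 3))
    refine lt_of_lt_of_eq hpos (Eq.trans ?_ hd.deriv.symm)
    simp only [Pi.neg_apply]
    ring
  have h := hmono (left_mem_Icc.2 hT.1.le) (right_mem_Icc.2 hT.1.le) hT.1
  simp only [hw0, mul_zero] at h
  exact pos_of_mul_pos_right h (Real.exp_pos _).le

/-- For `θ = 0` and nonincreasing `ρ`, the flux `a³ w' = z + g ρ w` never exceeds its initial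
value as long as `w` is nondecreasing. -/
lemma IsSolS.flux_le (hs : IsSolS p0 g lam 0 a ρ w z) (hg : 0 ≤ g)
    (hρmono : AntitoneOn ρ (Icc p0 0)) (hw0 : w p0 = 0) {t : ℝ} (ht : t ∈ Icc p0 0)
    (hw' : ∀ p ∈ Ioo p0 t, 0 ≤ g * ρ p / (a p) ^ 3 * w p + z p / (a p) ^ 3) :
    z t + g * ρ t * w t ≤ z p0 := by
  have hanti : AntitoneOn (fun p => z p + g * ρ t * w p) (Icc p0 t) := by
    refine antitoneOn_of_deriv_nonpos (convex_Icc _ _)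
      ((hs.continuousOn_snd.add (continuousOn_const.mul hs.continuousOn_fst)).mono
        (Icc_subset_Icc_right ht.2)) ?_ ?_ <;> rw [interior_Icc] <;> intro p hp <;>
      have hp' : p ∈ Ioo p0 0 := ⟨hp.1, hp.2.trans_le ht.2⟩ <;>
      have hd := (hs.hasDerivAt_snd_of_zero hp').add
        ((hs.hasDerivAt_fst hp').const_mul (g * ρ t))
    · exact hd.differentiableAt.differentiableWithinAt
    · refine hd.deriv.le.trans ?_
      have hρ : g * ρ t ≤ g * ρ p :=
        mul_le_mul_of_nonneg_left (hρmono (Ioo_subset_Icc_self hp') ht hp.2.le) hg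
      rw [← add_mul]
      exact mul_nonpos_of_nonpos_of_nonneg (by linarith) (hw' p hp)
  have h := hanti (left_mem_Icc.2 ht.1) (right_mem_Icc.2 ht.1) ht.1
  simpa [hw0] using h

/-- For `θ = 0` and nonincreasing `ρ`, `z` is bounded below by `z(p0) (1 - A)` as long as it was
positive before. -/
lemma IsSolS.le_snd (hs : IsSolS p0 g lam 0 a ρ w z) (hg : 0 ≤ g)
    (ha : ContinuousOn a (Icc p0 0)) (hapos : ∀ p ∈ Icc p0 (0 : ℝ), 0 < a p)
    (hρc : ContinuousOn ρ (Icc p0 0)) (hρpos : ∀ p ∈ Icc p0 (0 : ℝ), 0 < ρ p)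
    (hρmono : AntitoneOn ρ (Icc p0 0)) (hw0 : w p0 = 0) {T : ℝ} (hT : T ∈ Ioc p0 0)
    (hz : ∀ p ∈ Ioo p0 T, 0 < z p) :
    z p0 * (1 - Afun p0 g a ρ T) ≤ z T := by
  have hsub : Icc p0 T ⊆ Icc p0 0 := Icc_subset_Icc_right hT.2
  have hw' : ∀ p ∈ Ioo p0 T, 0 ≤ g * ρ p / (a p) ^ 3 * w p + z p / (a p) ^ 3 := by
    intro p hp
    have hpI : p ∈ Icc p0 0 := hsub (Ioo_subset_Icc_self hp)
    have hw := hs.fst_pos ha hapos hρc hw0 ⟨hp.1, hpI.2⟩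
      fun q hq => hz q ⟨hq.1, hq.2.trans hp.2⟩
    have := hapos p hpI
    have := hρpos p hpI
    have := hz p hp
    positivity
  have hmono : MonotoneOn (fun p => z p + z p0 * Afun p0 g a ρ p) (Icc p0 T) := by
    refine monotoneOn_of_deriv_nonneg (convex_Icc _ _)
      ((hs.continuousOn_snd.add (continuousOn_const.mul
        (continuousOn_Afun (hT.1.le.trans hT.2) ha hapos hρc))).mono hsub) ?_ ?_ <;>
      rw [interior_Icc] <;> intro p hp <;>
      have hp' : p ∈ Ioo p0 0 := ⟨hp.1, hp.2.trans_le hT.2⟩ <;>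
      have hd := (hs.hasDerivAt_snd_of_zero hp').add
        ((hasDerivAt_Afun (g := g) ha hapos hρc hp').const_mul (z p0))
    · exact hd.differentiableAt.differentiableWithinAt
    · have hpI : p ∈ Icc p0 0 := Ioo_subset_Icc_self hp'
      have hflux := hs.flux_le hg hρmono hw0 hpI
        fun q hq => hw' q ⟨hq.1, hq.2.trans hp.2⟩
      have hap := hapos p hpI
      have hρp := hρpos p hpI
      have hpos : 0 ≤ g * ρ p / (a p) ^ 3 * (z p0 - (z p + g * ρ p * w p)) :=
        mul_nonneg (by positivity) (by linarith)
      refine hpos.trans_eq (Eq.trans ?_ hd.deriv.symm)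
      ring
  have h := hmono (left_mem_Icc.2 hT.1.le) (right_mem_Icc.2 hT.1.le) hT.1.le
  have hA0 : Afun p0 g a ρ p0 = 0 := intervalIntegral.integral_same
  simp only [hA0, mul_zero, add_zero] at h
  linarith

end Solution

/-- if `ρ̄` is nonincreasing and `e^{2A(0)} − 2A(0) ≤ 5`, then the solution of
`S(λ,0)` with `w(p0) = 0`, `z(p0) = a(p0)³` (i.e. `w'(p0) = 1`) satisfies `z > 0` and `w' > 0`
on `[p0,0]`, and `w > 0` on `(p0,0]`. -/
theorem theta_zero_solution_positive
    (p0 g lam : ℝ) (hp0 : p0 < 0) (hg : 0 < g) (hlam : 0 < lam)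
    (a ρ : ℝ → ℝ)
    (ha : ContinuousOn a (Set.Icc p0 0)) (hapos : ∀ p ∈ Set.Icc p0 (0:ℝ), 0 < a p)
    (hρc : ContinuousOn ρ (Set.Icc p0 0)) (hρpos : ∀ p ∈ Set.Icc p0 (0:ℝ), 0 < ρ p)
    (hρmono : AntitoneOn ρ (Set.Icc p0 0))
    (hA : Real.exp (2 * Afun p0 g a ρ 0) - 2 * Afun p0 g a ρ 0 ≤ 5)
    (w z : ℝ → ℝ)
    (hs : IsSolS p0 g lam 0 a ρ w z)
    (hw0 : w p0 = 0) (hz0 : z p0 = (a p0) ^ 3) :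
    (∀ p ∈ Set.Icc p0 (0:ℝ),
      0 < z p ∧ 0 < g * ρ p / (a p) ^ 3 * w p + z p / (a p) ^ 3) ∧
    ∀ p ∈ Set.Ioc p0 (0:ℝ), 0 < w p := by
  have hz0pos : 0 < z p0 := hz0 ▸ pow_pos (hapos p0 ⟨le_rfl, hp0.le⟩) 3
  have hAmono : MonotoneOn (Afun p0 g a ρ) (Icc p0 0) := by
    refine monotoneOn_of_deriv_nonneg (convex_Icc _ _)
      (continuousOn_Afun hp0.le ha hapos hρc) ?_ ?_ <;> rw [interior_Icc] <;> intro p hp <;>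
      have hd := hasDerivAt_Afun (g := g) ha hapos hρc hp
    · exact hd.differentiableAt.differentiableWithinAt
    · have := hapos p (Ioo_subset_Icc_self hp)
      have := hρpos p (Ioo_subset_Icc_self hp)
      rw [hd.deriv]
      positivity
  have hAlt : ∀ p ∈ Icc p0 0, Afun p0 g a ρ p < 1 := fun p hp =>
    (hAmono hp ⟨hp0.le, le_rfl⟩ hp.2).trans_lt (lt_one_of_exp_two_mul_sub_le_five hA)
  have hzpos : ∀ p ∈ Icc p0 0, 0 < z p := by
    by_contra! hne
    have hcomp : IsCompact (Icc p0 0 ∩ z ⁻¹' Iic 0) :=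
      isCompact_Icc.of_isClosed_subset
        (hs.continuousOn_snd.preimage_isClosed_of_isClosed isClosed_Icc isClosed_Iic)
        inter_subset_left
    obtain ⟨T, ⟨hT, hzT⟩, hleast⟩ := hcomp.exists_isLeast hne
    have hTp0 : p0 < T := lt_of_le_of_ne hT.1 fun h => hz0pos.not_ge (h ▸ hzT)
    have hbound := hs.le_snd hg.le ha hapos hρc hρpos hρmono hw0 ⟨hTp0, hT.2⟩ fun p hp => by
      by_contra! hzp
      exact hp.2.not_ge (hleast ⟨⟨hp.1.le, hp.2.le.trans hT.2⟩, hzp⟩)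
    exact (mul_pos hz0pos (sub_pos.2 (hAlt T hT))).not_ge (hbound.trans hzT)
  have hwpos : ∀ p ∈ Ioc p0 0, 0 < w p := fun p hp =>
    hs.fst_pos ha hapos hρc hw0 hp fun q hq => hzpos q ⟨hq.1.le, hq.2.le.trans hp.2⟩
  refine ⟨fun p hp => ⟨hzpos p hp, ?_⟩, hwpos⟩
  have hw : 0 ≤ w p := by
    rcases hp.1.eq_or_lt with rfl | h
    · exact hw0.ge
    · exact (hwpos p ⟨h, hp.2⟩).le
  have := hapos p hp
  have := hρpos p hp
  have := hzpos p hp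
  positivity
end

section
/- Assume in addition that ρ̄ is nonincreasing on [p0,0]. Let λ > 0 and let θ ∈ ℝ satisfy θ/λ² ≥ g² ρ̄(p0)² / (min_{[p0,0]} a)⁴. Let (w, z) be the solution of the system S(λ,θ) on [p0,0] with w(p0) = 0 and z(p0) = a(p0)³. Then the functions p ↦ z(p) e^{A(p)} and p ↦ w(p) are nondecreasing on [p0,0], and z(p) ≥ a(p0)³ e^{−A(p)} > 0 for all p ∈ [p0,0]. -/
open MeasureTheory Set

/-- A function on `[a, b]` with nonnegative one-sided derivative is monotone there. -/
lemma monotoneOn_Icc_of_hasDerivWithinAt_nonneg {f f' : ℝ → ℝ} {a b : ℝ}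
    (hf : ∀ x ∈ Icc a b, HasDerivWithinAt f (f' x) (Icc a b) x)
    (hf' : ∀ x ∈ Ioo a b, 0 ≤ f' x) : MonotoneOn f (Icc a b) := by
  refine monotoneOn_of_hasDerivWithinAt_nonneg (f' := f') (convex_Icc a b)
    (fun x hx => (hf x hx).continuousWithinAt)
    (fun x hx => (hf x (interior_subset hx)).mono interior_subset) ?_
  rwa [interior_Icc]

/-- If `x' = α y`, `y' = β x` with `α, β ≥ 0`, `x` initially nonnegative and `y` initially
positive, then `y` stays positive and both components are nondecreasing. -/
lemma cooperative_system_monotoneOn {x y α β : ℝ → ℝ} {a b : ℝ}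
    (hx : ∀ p ∈ Icc a b, HasDerivWithinAt x (α p * y p) (Icc a b) p)
    (hy : ∀ p ∈ Icc a b, HasDerivWithinAt y (β p * x p) (Icc a b) p)
    (hα : ∀ p ∈ Icc a b, 0 ≤ α p) (hβ : ∀ p ∈ Icc a b, 0 ≤ β p)
    (hxa : 0 ≤ x a) (hya : 0 < y a) :
    (∀ p ∈ Icc a b, 0 < y p) ∧ MonotoneOn x (Icc a b) ∧ MonotoneOn y (Icc a b) := by
  have key : ∀ c ∈ Icc a b, (∀ p ∈ Ioo a c, 0 ≤ y p) →
      MonotoneOn x (Icc a c) ∧ MonotoneOn y (Icc a c) := by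
    intro c hc hpos
    have hsub : Icc a c ⊆ Icc a b := Icc_subset_Icc_right hc.2
    have hxm : MonotoneOn x (Icc a c) :=
      monotoneOn_Icc_of_hasDerivWithinAt_nonneg (fun p hp => (hx p (hsub hp)).mono hsub)
        fun p hp => mul_nonneg (hα p (hsub (Ioo_subset_Icc_self hp))) (hpos p hp)
    refine ⟨hxm, monotoneOn_Icc_of_hasDerivWithinAt_nonneg
      (fun p hp => (hy p (hsub hp)).mono hsub) fun p hp => ?_⟩
    have hp' := Ioo_subset_Icc_self hp
    exact mul_nonneg (hβ p (hsub hp')) (hxa.trans (hxm (left_mem_Icc.2 hc.1) hp' hp'.1))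
  have hpos : ∀ p ∈ Icc a b, 0 < y p := by
    by_contra! hne
    have hycont : ContinuousOn y (Icc a b) := fun p hp => (hy p hp).continuousWithinAt
    have hcompact : IsCompact (Icc a b ∩ y ⁻¹' Iic 0) :=
      isCompact_Icc.of_isClosed_subset
        (hycont.preimage_isClosed_of_isClosed isClosed_Icc isClosed_Iic) inter_subset_left
    obtain ⟨q, hq⟩ := hne
    obtain ⟨c, ⟨hc, hyc⟩, hleast⟩ := hcompact.exists_isLeast ⟨q, hq⟩
    have hmono := (key c hc fun p hp => by
      by_contra! hneg
      exact hp.2.not_ge (hleast ⟨⟨hp.1.le, hp.2.le.trans hc.2⟩, hneg.le⟩)).2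
    exact (hya.trans_le (hmono (left_mem_Icc.2 hc.1) (right_mem_Icc.2 hc.1) hc.1)).not_ge hyc
  refine ⟨hpos, ?_⟩
  rcases le_or_gt a b with hab | hab
  · exact key b (right_mem_Icc.2 hab) fun p hp => (hpos p (Ioo_subset_Icc_self hp)).le
  · simp [Icc_eq_empty_of_lt hab, MonotoneOn]

/-- The integral from the left endpoint of a function continuous on `[a, b]` is a one-sided
primitive on `[a, b]`. -/
lemma hasDerivWithinAt_integral_Icc {f : ℝ → ℝ} {a b p : ℝ} (hf : ContinuousOn f (Icc a b))
    (hp : p ∈ Icc a b) :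
    HasDerivWithinAt (fun q => ∫ s in a..q, f s) (f p) (Icc a b) p := by
  have : Fact (p ∈ Icc a b) := ⟨hp⟩
  refine intervalIntegral.integral_hasDerivWithinAt_right ?_
    (hf.stronglyMeasurableAtFilter_nhdsWithin measurableSet_Icc p) (hf p hp)
  refine ContinuousOn.intervalIntegrable ?_
  rw [uIcc_of_le hp.1]
  exact hf.mono (Icc_subset_Icc_right hp.2)

/-- The lower bound on `θ` makes the coefficient of `w` in the equation for `z` nonnegative. -/
lemma potential_nonneg {K : Set ℝ} {q g lam θ : ℝ} {a ρ : ℝ → ℝ} (hK : IsCompact K)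
    (hq : ∀ p ∈ K, q ≤ p) (hqK : q ∈ K)
    (ha : ContinuousOn a K) (hapos : ∀ p ∈ K, 0 < a p)
    (hρpos : ∀ p ∈ K, 0 < ρ p) (hρmono : AntitoneOn ρ K)
    (hθ : g ^ 2 * (ρ q) ^ 2 / (sInf (a '' K)) ^ 4 ≤ θ / lam ^ 2) {p : ℝ} (hp : p ∈ K) :
    0 ≤ θ * a p / lam ^ 2 - g ^ 2 * (ρ p) ^ 2 / (a p) ^ 3 := by
  have hcompact : IsCompact (a '' K) := hK.image_of_continuousOn ha
  have hmin : 0 < sInf (a '' K) := by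
    obtain ⟨r, hr, hreq⟩ := hcompact.sInf_mem ⟨_, mem_image_of_mem a hqK⟩
    exact hreq ▸ hapos r hr
  have hle : sInf (a '' K) ≤ a p := csInf_le hcompact.bddBelow (mem_image_of_mem a hp)
  have hap := hapos p hp
  have hρle : ρ p ≤ ρ q := hρmono hqK hp (hq p hp)
  have hρp := hρpos p hp
  have hbound : g ^ 2 * (ρ p) ^ 2 / (a p) ^ 4 ≤ θ / lam ^ 2 :=
    le_trans (by gcongr) hθ
  have heq : θ * a p / lam ^ 2 - g ^ 2 * (ρ p) ^ 2 / (a p) ^ 3 =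
      a p * (θ / lam ^ 2 - g ^ 2 * (ρ p) ^ 2 / (a p) ^ 4) := by
    have h : g ^ 2 * (ρ p) ^ 2 / (a p) ^ 3 = a p * (g ^ 2 * (ρ p) ^ 2 / (a p) ^ 4) := by
      field_simp
    rw [h]; ring
  rw [heq]
  exact mul_nonneg hap.le (sub_nonneg.2 hbound)

/-- if `ρ̄` is nonincreasing and `θ/λ² ≥ g²ρ̄(p0)²/(min_{[p0,0]} a)⁴`, then for
the solution of `S(λ,θ)` with `w(p0) = 0`, `z(p0) = a(p0)³`, the functions `z e^A` and `w` are
nondecreasing on `[p0,0]` and `z(p) ≥ a(p0)³ e^{−A(p)} > 0` on `[p0,0]`. -/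
theorem large_theta_solution_monotone
    (p0 g lam θ : ℝ) (hp0 : p0 < 0) (hg : 0 < g) (hlam : 0 < lam)
    (a ρ : ℝ → ℝ)
    (ha : ContinuousOn a (Set.Icc p0 0)) (hapos : ∀ p ∈ Set.Icc p0 (0:ℝ), 0 < a p)
    (hρc : ContinuousOn ρ (Set.Icc p0 0)) (hρpos : ∀ p ∈ Set.Icc p0 (0:ℝ), 0 < ρ p)
    (hρmono : AntitoneOn ρ (Set.Icc p0 0))
    (hθ : g ^ 2 * (ρ p0) ^ 2 / (sInf (a '' Set.Icc p0 0)) ^ 4 ≤ θ / lam ^ 2)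
    (w z : ℝ → ℝ)
    (hs : IsSolS p0 g lam θ a ρ w z)
    (hw0 : w p0 = 0) (hz0 : z p0 = (a p0) ^ 3) :
    MonotoneOn (fun p => z p * Real.exp (Afun p0 g a ρ p)) (Set.Icc p0 0) ∧
    MonotoneOn w (Set.Icc p0 0) ∧
    ∀ p ∈ Set.Icc p0 (0:ℝ),
      (a p0) ^ 3 * Real.exp (-(Afun p0 g a ρ p)) ≤ z p ∧
      0 < (a p0) ^ 3 * Real.exp (-(Afun p0 g a ρ p)) := by
  have hleft : p0 ∈ Icc p0 (0 : ℝ) := left_mem_Icc.2 hp0.le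
  have hA : ∀ p ∈ Icc p0 (0 : ℝ),
      HasDerivWithinAt (Afun p0 g a ρ) (g * ρ p / (a p) ^ 3) (Icc p0 0) p := fun p hp =>
    hasDerivWithinAt_integral_Icc (f := fun s => g * ρ s / (a s) ^ 3)
      ((continuousOn_const.mul hρc).div (ha.pow 3) fun s hs => (pow_pos (hapos s hs) 3).ne') hp
  have hA0 : Afun p0 g a ρ p0 = 0 := intervalIntegral.integral_same
  set A := Afun p0 g a ρ
  have hU : ∀ p ∈ Icc p0 (0 : ℝ), HasDerivWithinAt (fun q => w q * Real.exp (-A q))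
      (Real.exp (-A p) ^ 2 / (a p) ^ 3 * (z p * Real.exp (A p))) (Icc p0 0) p := by
    intro p hp
    refine ((hs p hp).1.mul (hA p hp).neg.exp).congr_deriv ?_
    have hexp : Real.exp (-A p) * Real.exp (A p) = 1 := by rw [← Real.exp_add]; simp
    linear_combination (-(z p / (a p) ^ 3 * Real.exp (-A p))) * hexp
  have hZ : ∀ p ∈ Icc p0 (0 : ℝ), HasDerivWithinAt (fun q => z q * Real.exp (A q))
      ((θ * a p / lam ^ 2 - g ^ 2 * (ρ p) ^ 2 / (a p) ^ 3) * Real.exp (A p) ^ 2 *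
        (w p * Real.exp (-A p))) (Icc p0 0) p := by
    intro p hp
    refine ((hs p hp).2.mul (hA p hp).exp).congr_deriv ?_
    have hexp : Real.exp (-A p) * Real.exp (A p) = 1 := by rw [← Real.exp_add]; simp
    linear_combination (-((θ * a p / lam ^ 2 - g ^ 2 * (ρ p) ^ 2 / (a p) ^ 3) * w p *
      Real.exp (A p))) * hexp
  have ha0 : 0 < (a p0) ^ 3 := pow_pos (hapos p0 hleft) 3
  obtain ⟨hZpos, hUmono, hZmono⟩ := cooperative_system_monotoneOn
    (α := fun p => Real.exp (-A p) ^ 2 / (a p) ^ 3)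
    (β := fun p => (θ * a p / lam ^ 2 - g ^ 2 * (ρ p) ^ 2 / (a p) ^ 3) * Real.exp (A p) ^ 2)
    hU hZ
    (fun p hp => by have := hapos p hp; positivity)
    (fun p hp => mul_nonneg (potential_nonneg isCompact_Icc (fun _ hr => hr.1) hleft ha hapos
      hρpos hρmono hθ hp) (sq_nonneg _))
    (by simp [hw0]) (by simpa [hA0, hz0] using ha0)
  refine ⟨hZmono, ?_, fun p hp => ⟨?_, mul_pos ha0 (Real.exp_pos _)⟩⟩
  · refine monotoneOn_Icc_of_hasDerivWithinAt_nonneg (fun p hp => (hs p hp).1) fun p hp => ?_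
    have hp' := Ioo_subset_Icc_self hp
    have hw : 0 ≤ w p := by
      have h := hUmono hleft hp' hp'.1
      simp only [hw0, zero_mul] at h
      exact nonneg_of_mul_nonneg_left h (Real.exp_pos _)
    have hz : 0 < z p := pos_of_mul_pos_left (hZpos p hp') (Real.exp_pos _).le
    have hap := hapos p hp'
    have hρp := hρpos p hp'
    positivity
  · have h := hZmono hleft hp hp.1
    simp only [hA0, hz0, Real.exp_zero, mul_one] at h
    rwa [Real.exp_neg, ← div_eq_mul_inv, div_le_iff₀ (Real.exp_pos _)]
end

section
/- Let g, ρ, σ, d > 0 and p0 < 0 be real with g ρ d < p0²/d². Then there exists exactly one x ∈ (0, ∞) satisfying the dispersion relation (g ρ + σ x²) tanh(d x) = (p0²/d²) x. -/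
open Set in
/-- A function vanishing at `0` with positive derivative on `(0, ∞)` is positive there. -/
theorem pos_of_hasDerivAt_pos {f f' : ℝ → ℝ} (hf : ∀ x, HasDerivAt f (f' x) x)
    (h0 : f 0 = 0) (hpos : ∀ x, 0 < x → 0 < f' x) {t : ℝ} (ht : 0 < t) : 0 < f t := by
  have hmono : StrictMonoOn f (Ici 0) := by
    refine strictMonoOn_of_deriv_pos (convex_Ici 0)
      (fun x _ => (hf x).continuousAt.continuousWithinAt) fun x hx => ?_
    rw [interior_Ici] at hx
    rw [(hf x).deriv]
    exact hpos x hx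
  simpa [h0] using hmono self_mem_Ici ht.le ht

theorem Real.sinh_lt_mul_cosh {t : ℝ} (ht : 0 < t) : Real.sinh t < t * Real.cosh t := by
  have h : 0 < t * Real.cosh t - Real.sinh t := by
    refine pos_of_hasDerivAt_pos (f := fun s => s * Real.cosh s - Real.sinh s)
      (f' := fun s => s * Real.sinh s) (fun s => ?_) (by simp)
      (fun s hs => mul_pos hs (Real.sinh_pos_iff.2 hs)) ht
    refine HasDerivAt.congr_deriv (((hasDerivAt_id s).mul (Real.hasDerivAt_cosh s)).sub
      (Real.hasDerivAt_sinh s)) ?_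
    simp
  linarith

theorem Real.four_mul_cosh_sub_one_lt {s : ℝ} (hs : 0 < s) :
    4 * (Real.cosh s - 1) < s * Real.sinh s + s ^ 2 := by
  have h₂ : ∀ s : ℝ, 0 < s → 0 < s * Real.sinh s - 2 * Real.cosh s + 2 := fun s hs => by
    refine pos_of_hasDerivAt_pos (f := fun s => s * Real.sinh s - 2 * Real.cosh s + 2)
      (f' := fun s => s * Real.cosh s - Real.sinh s) (fun s => ?_) (by simp)
      (fun s hs => sub_pos.2 (Real.sinh_lt_mul_cosh hs)) hs
    refine HasDerivAt.congr_deriv ((((hasDerivAt_id s).mul (Real.hasDerivAt_sinh s)).sub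
      ((Real.hasDerivAt_cosh s).const_mul 2)).add_const 2) ?_
    simp only [id]
    ring
  have h₁ : ∀ s : ℝ, 0 < s → 0 < s * Real.cosh s + 2 * s - 3 * Real.sinh s := fun s hs => by
    refine pos_of_hasDerivAt_pos (f := fun s => s * Real.cosh s + 2 * s - 3 * Real.sinh s)
      (f' := fun s => s * Real.sinh s - 2 * Real.cosh s + 2) (fun s => ?_) (by simp) h₂ hs
    refine HasDerivAt.congr_deriv ((((hasDerivAt_id s).mul (Real.hasDerivAt_cosh s)).add
      ((hasDerivAt_id s).const_mul 2)).sub ((Real.hasDerivAt_sinh s).const_mul 3)) ?_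
    simp only [id]
    ring
  have h₀ : 0 < s * Real.sinh s + s ^ 2 - 4 * (Real.cosh s - 1) := by
    refine pos_of_hasDerivAt_pos (f := fun s => s * Real.sinh s + s ^ 2 - 4 * (Real.cosh s - 1))
      (f' := fun s => s * Real.cosh s + 2 * s - 3 * Real.sinh s) (fun s => ?_) (by simp) h₁ hs
    refine HasDerivAt.congr_deriv ((((hasDerivAt_id s).mul (Real.hasDerivAt_sinh s)).add
      (hasDerivAt_pow 2 s)).sub
      (((Real.hasDerivAt_cosh s).sub_const 1).const_mul 4)) ?_
    simp only [id]
    push_cast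
    ring
  linarith

theorem Real.two_mul_sinh_sq_lt {t : ℝ} (ht : 0 < t) :
    2 * Real.sinh t ^ 2 < t * Real.sinh t * Real.cosh t + t ^ 2 := by
  have h := Real.four_mul_cosh_sub_one_lt (mul_pos two_pos ht)
  rw [Real.cosh_two_mul, Real.sinh_two_mul, Real.cosh_sq] at h
  linarith

open Set in
/-- The function `(t coth t - 1) / t²` is strictly decreasing on `(0, ∞)`. -/
theorem strictAntiOn_mul_coth_sub_one_div_sq :
    StrictAntiOn (fun t : ℝ => (t * Real.cosh t - Real.sinh t) / (t ^ 2 * Real.sinh t))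
      (Ioi 0) := by
  have hderiv : ∀ t : ℝ, 0 < t → HasDerivAt
      (fun t : ℝ => (t * Real.cosh t - Real.sinh t) / (t ^ 2 * Real.sinh t))
      (-(t * (t * Real.sinh t * Real.cosh t + t ^ 2 - 2 * Real.sinh t ^ 2)) /
        (t ^ 2 * Real.sinh t) ^ 2) t := fun t ht => by
    have hs : 0 < Real.sinh t := Real.sinh_pos_iff.2 ht
    refine HasDerivAt.congr_deriv ((((hasDerivAt_id t).mul (Real.hasDerivAt_cosh t)).sub
      (Real.hasDerivAt_sinh t)).div
      ((hasDerivAt_pow 2 t).mul (Real.hasDerivAt_sinh t)) (by simp [ht.ne', hs.ne'])) ?_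
    simp only [id, Pi.mul_apply, Pi.sub_apply]
    congr 1
    push_cast
    linear_combination (-t ^ 3) * Real.cosh_sq t
  refine strictAntiOn_of_deriv_neg (convex_Ioi 0)
    (fun t ht => (hderiv t ht).continuousAt.continuousWithinAt) fun t ht => ?_
  rw [interior_Ioi] at ht
  have ht : 0 < t := ht
  have hs : 0 < Real.sinh t := Real.sinh_pos_iff.2 ht
  rw [(hderiv t ht).deriv]
  refine div_neg_of_neg_of_pos (neg_neg_of_pos (mul_pos ht ?_)) (by positivity)
  linarith [Real.two_mul_sinh_sq_lt ht]

/-- A positive root of `(a + b t²) tanh t = c t` is a point where a decreasing function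
takes the value `b`. -/
theorem eq_of_mul_tanh_eq {a b c t : ℝ} (ht : 0 < t)
    (h : (a + b * t ^ 2) * Real.tanh t = c * t) :
    c * ((t * Real.cosh t - Real.sinh t) / (t ^ 2 * Real.sinh t)) + (c - a) / t ^ 2 = b := by
  have hs : 0 < Real.sinh t := Real.sinh_pos_iff.2 ht
  have hc : 0 < Real.cosh t := Real.cosh_pos t
  rw [Real.tanh_eq_sinh_div_cosh] at h
  field_simp at h ⊢
  linarith

theorem not_lt_of_mul_tanh_eq {a b c s t : ℝ} (hc : 0 < c) (hac : a < c) (hs : 0 < s)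
    (ht : 0 < t) (h₁ : (a + b * s ^ 2) * Real.tanh s = c * s)
    (h₂ : (a + b * t ^ 2) * Real.tanh t = c * t) : ¬ s < t := by
  intro hst
  have h := mul_lt_mul_of_pos_left (strictAntiOn_mul_coth_sub_one_div_sq hs ht hst) hc
  have h' : (c - a) / t ^ 2 < (c - a) / s ^ 2 :=
    div_lt_div_of_pos_left (sub_pos.2 hac) (by positivity) (by gcongr)
  have e₁ := eq_of_mul_tanh_eq hs h₁
  have e₂ := eq_of_mul_tanh_eq ht h₂
  simp only at h
  linarith

theorem exists_pos_mul_tanh_eq {a b c : ℝ} (ha : 0 < a) (hb : 0 < b) (hac : a < c) :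
    ∃ t : ℝ, 0 < t ∧ (a + b * t ^ 2) * Real.tanh t = c * t := by
  set u := √((c - a) / b) with hu
  have hu0 : 0 < u := Real.sqrt_pos.2 (div_pos (sub_pos.2 hac) hb)
  have husq : a + b * u ^ 2 = c := by
    rw [hu, Real.sq_sqrt (div_pos (sub_pos.2 hac) hb).le]
    field_simp
    ring
  have hlow : Real.tanh u < u := by
    rw [Real.tanh_eq_sinh_div_cosh, div_lt_iff₀ (Real.cosh_pos u)]
    exact Real.sinh_lt_mul_cosh hu0
  have htanh : 0 < Real.tanh u := by
    rw [Real.tanh_eq_sinh_div_cosh]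
    exact div_pos (Real.sinh_pos_iff.2 hu0) (Real.cosh_pos u)
  have hc : 0 < c := ha.trans hac
  set v := u + c / (b * Real.tanh u) with hv
  have huv : u ≤ v := le_add_of_nonneg_right (by positivity)
  have hv0 : 0 < v := hu0.trans_le huv
  have htv : Real.tanh u ≤ Real.tanh v := by
    rwa [← Real.artanh_le_artanh_iff ⟨Real.neg_one_lt_tanh u, Real.tanh_lt_one u⟩
      ⟨Real.neg_one_lt_tanh v, Real.tanh_lt_one v⟩, Real.artanh_tanh, Real.artanh_tanh]
  have hbv : c ≤ b * Real.tanh u * v := by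
    have : b * Real.tanh u * v = b * Real.tanh u * u + c := by
      rw [hv]
      field_simp
    rw [this]
    exact le_add_of_nonneg_left (by positivity)
  have hhigh : c * v ≤ (a + b * v ^ 2) * Real.tanh v :=
    calc c * v ≤ b * Real.tanh u * v * v := by gcongr
      _ = b * v ^ 2 * Real.tanh u := by ring
      _ ≤ (a + b * v ^ 2) * Real.tanh v := by
        gcongr
        linarith
  have hcont : Continuous fun t : ℝ => (a + b * t ^ 2) * Real.tanh t - c * t := by
    have : Continuous Real.tanh := by
      simp only [funext Real.tanh_eq_sinh_div_cosh]
      exact Real.continuous_sinh.div Real.continuous_cosh fun t => (Real.cosh_pos t).ne'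
    fun_prop
  obtain ⟨t, ht, hzero⟩ := intermediate_value_Icc huv hcont.continuousOn
    (show (0 : ℝ) ∈ Set.Icc _ _ from
      ⟨by simp only [husq]; nlinarith, by linarith⟩)
  exact ⟨t, hu0.trans_le ht.1, sub_eq_zero.1 hzero⟩


/-- for `g, ρ, σ, d > 0`, `p0 < 0` with `gρd < p0²/d²`, the dispersion relation
`(gρ + σx²) tanh(dx) = (p0²/d²) x` has exactly one solution `x ∈ (0,∞)`. -/
theorem dispersion_relation_unique_root
    (g ρ σ d p0 : ℝ) (hg : 0 < g) (hρ : 0 < ρ) (hσ : 0 < σ) (hd : 0 < d)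
    (hp0 : p0 < 0) (hsize : g * ρ * d < p0 ^ 2 / d ^ 2) :
    ∃! x : ℝ, 0 < x ∧ (g * ρ + σ * x ^ 2) * Real.tanh (d * x) = p0 ^ 2 / d ^ 2 * x := by
  have hac : g * ρ < p0 ^ 2 / d ^ 2 / d := (lt_div_iff₀ hd).2 hsize
  have ha : 0 < g * ρ := mul_pos hg hρ
  have hrescale : ∀ x : ℝ,
      (g * ρ + σ * x ^ 2) * Real.tanh (d * x) = p0 ^ 2 / d ^ 2 * x ↔
      (g * ρ + σ / d ^ 2 * (d * x) ^ 2) * Real.tanh (d * x) =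
        p0 ^ 2 / d ^ 2 / d * (d * x) := fun x => by
    have h₁ : σ / d ^ 2 * (d * x) ^ 2 = σ * x ^ 2 := by field_simp
    have h₂ : p0 ^ 2 / d ^ 2 / d * (d * x) = p0 ^ 2 / d ^ 2 * x := by field_simp
    rw [h₁, h₂]
  obtain ⟨t, ht, hroot⟩ := exists_pos_mul_tanh_eq ha (by positivity : 0 < σ / d ^ 2) hac
  have htd : d * (t / d) = t := mul_div_cancel₀ t hd.ne'
  refine ⟨t / d, ⟨div_pos ht hd, (hrescale _).2 (by rwa [htd])⟩, ?_⟩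
  rintro y ⟨hy, hyroot⟩
  have hyroot := (hrescale y).1 hyroot
  have hdy : 0 < d * y := mul_pos hd hy
  have hcpos := ha.trans hac
  rw [eq_div_iff hd.ne', mul_comm]
  exact le_antisymm (not_lt.1 (not_lt_of_mul_tanh_eq hcpos hac ht hdy hroot hyroot))
    (not_lt.1 (not_lt_of_mul_tanh_eq hcpos hac hdy ht hyroot hroot))
end
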